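/- Let 0 < α < β be real numbers and let f belong to the class 𝓕. There exists a continuous homogeneously multifractal (HM) function Z : [0,1] → [0,1] such that: (1) for all h in (α + (β−α)·Support*(f)) \ {β}, d_Z(h) = max( f((h−α)/(β−α)), 0 ); (2) d_Z(h) = −∞ for all h ∉ α + (β−α)·Support*(f); (3) the set {x ∈ [0,1] : h_Z(x) = β} has Lebesgue measure 1. -/

import Mathlib

open MeasureTheory Metric Filter Set
open scoped ENNReal Topology
open Classical

/-- `Z ∈ C^α(x₀)`: there are a polynomial `P` of degree less than `α` and a constant `C > 0`
such that `|Z x - P (x - x₀)| ≤ C |x - x₀| ^ α` in a neighborhood of `x₀`. -/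
def HolderAt (Z : ℝ → ℝ) (α : ℝ) (x₀ : ℝ) : Prop :=
  ∃ (P : Polynomial ℝ) (C δ : ℝ), 0 < C ∧ 0 < δ ∧
    (P = 0 ∨ (P.natDegree : ℝ) < α) ∧
    ∀ x : ℝ, |x - x₀| < δ → |Z x - P.eval (x - x₀)| ≤ C * |x - x₀| ^ α

/-- The pointwise Hölder exponent `h_Z(x₀) = sup {α ≥ 0 : Z ∈ C^α(x₀)}`. -/
noncomputable def holderExp (Z : ℝ → ℝ) (x₀ : ℝ) : EReal :=
  sSup {h : EReal | ∃ α : ℝ, 0 ≤ α ∧ HolderAt Z α x₀ ∧ h = (α : EReal)}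

/-- Hausdorff dimension of a set, with the convention `dim ∅ = -∞`. -/
noncomputable def dimHE (s : Set ℝ) : EReal :=
  if s.Nonempty then ((dimH s : ℝ≥0∞) : EReal) else ⊥

/-- The multifractal spectrum of a function on `[0,1]`:
`d_Z(h) = dim_H {x ∈ [0,1] : h_Z(x) = h}`, with `dim ∅ = -∞`. -/
noncomputable def specF (Z : ℝ → ℝ) (h : EReal) : EReal :=
  dimHE {x ∈ Set.Icc (0:ℝ) 1 | holderExp Z x = h}

/-- A function on `[0,1]` is homogeneously multifractal (HM) if its restriction to any
non-degenerate subinterval of `[0,1]` has the same multifractal spectrum as `Z` itself. -/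
def IsHMF (Z : ℝ → ℝ) : Prop :=
  ∀ a b : ℝ, 0 ≤ a → a < b → b ≤ 1 →
    ∀ h : EReal, dimHE {x ∈ Set.Ioo a b | holderExp Z x = h} = specF Z h

/-- The class `𝓕` of admissible spectra: suprema of countably many step functions `f_n`,
each supported by a closed subinterval `Iₙ ⊆ [0,1]`, bounded away from `0` uniformly,
constant (with value `vₙ ∈ [0,1]`) on `Iₙ`, with `fₙ(x) ≤ x` on `Iₙ`, and `f = sup_n fₙ`. -/
def MemF (f : ℝ → EReal) : Prop :=
  ∃ (I : ℕ → Set ℝ) (v : ℕ → EReal),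
    (∀ n, ∃ a b : ℝ, a ≤ b ∧ I n = Set.Icc a b) ∧
    (∀ n, I n ⊆ Set.Icc (0:ℝ) 1) ∧
    (∃ c : ℝ, 0 < c ∧ ∀ n, ∀ x ∈ I n, c ≤ x) ∧
    (∀ n, 0 ≤ v n ∧ v n ≤ 1) ∧
    (∀ n, ∀ x ∈ I n, v n ≤ (x : EReal)) ∧
    (∀ x : ℝ, f x = ⨆ n, (if x ∈ I n then v n else ⊥))

/-! ### Pointwise Hölder regularity -/

lemma Polynomial.exists_abs_eval_le (P : Polynomial ℝ) :
    ∃ C : ℝ, 0 < C ∧ ∀ t : ℝ, |t| ≤ 1 → |P.eval t| ≤ C := by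
  obtain ⟨C, hC⟩ := (isCompact_Icc (a := (-1 : ℝ)) (b := 1)).exists_bound_of_continuousOn
    P.continuous.continuousOn
  exact ⟨max C 1, by positivity, fun t ht => (hC t (abs_le.1 ht)).trans (le_max_left _ _)⟩

lemma HolderAt.mono {Z : ℝ → ℝ} {γ γ' x : ℝ} (h : HolderAt Z γ x) (h0 : 0 ≤ γ')
    (hle : γ' ≤ γ) : HolderAt Z γ' x := by
  obtain ⟨P, C, δ, hC, hδ, -, hP⟩ := h
  set n := ⌈γ'⌉₊ with hn
  have hmon : (Polynomial.X ^ n : Polynomial ℝ).Monic := Polynomial.monic_X_pow n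
  obtain ⟨D, hD, hDP⟩ := (P /ₘ Polynomial.X ^ n).exists_abs_eval_le
  refine ⟨P %ₘ Polynomial.X ^ n, C + D, min δ 1, by positivity, by positivity, ?_, ?_⟩
  · by_cases hz : P %ₘ Polynomial.X ^ n = 0
    · exact Or.inl hz
    · right
      have hdeg := Polynomial.degree_modByMonic_lt P hmon
      rw [Polynomial.degree_X_pow, Polynomial.degree_eq_natDegree hz] at hdeg
      have hlt : (P %ₘ Polynomial.X ^ n).natDegree < n := by exact_mod_cast hdeg
      exact Nat.lt_ceil.1 hlt
  · intro y hy
    have hy1 : |y - x| < 1 := hy.trans_le (min_le_right _ _)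
    have h1 := hP y (hy.trans_le (min_le_left _ _))
    have h2 := hDP (y - x) hy1.le
    have hdec : P.eval (y - x) = (P %ₘ Polynomial.X ^ n).eval (y - x)
        + (y - x) ^ n * (P /ₘ Polynomial.X ^ n).eval (y - x) := by
      conv_lhs => rw [← Polynomial.modByMonic_add_div P (Polynomial.X ^ n)]
      simp
    have e1 : |y - x| ^ γ ≤ |y - x| ^ γ' := by
      rcases (abs_nonneg (y - x)).eq_or_lt with h | h
      · rw [← h]
        rcases h0.eq_or_lt with h' | h'
        · rw [← h', Real.rpow_zero]
          exact Real.zero_rpow_le_one _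
        · rw [Real.zero_rpow h'.ne', Real.zero_rpow (h'.trans_le hle).ne']
      · exact Real.rpow_le_rpow_of_exponent_ge h hy1.le hle
    have e2 : |y - x| ^ n ≤ |y - x| ^ γ' := by
      rw [← Real.rpow_natCast]
      rcases (abs_nonneg (y - x)).eq_or_lt with h | h
      · rw [← h]
        rcases h0.eq_or_lt with h' | h'
        · rw [← h', Real.rpow_zero]
          exact Real.zero_rpow_le_one _
        · rw [Real.zero_rpow h'.ne', Real.zero_rpow (h'.trans_le (Nat.le_ceil _)).ne']
      · exact Real.rpow_le_rpow_of_exponent_ge h hy1.le (Nat.le_ceil _)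
    calc |Z y - (P %ₘ Polynomial.X ^ n).eval (y - x)|
        = |(Z y - P.eval (y - x)) + (y - x) ^ n * (P /ₘ Polynomial.X ^ n).eval (y - x)| := by
          rw [hdec]; congr 1; ring
      _ ≤ C * |y - x| ^ γ + |y - x| ^ n * D := by
          refine (abs_add_le _ _).trans (add_le_add h1 ?_)
          rw [abs_mul, abs_pow]
          gcongr
      _ ≤ (C + D) * |y - x| ^ γ' := by nlinarith

lemma HolderAt.add {Z W : ℝ → ℝ} {γ x : ℝ} (hZ : HolderAt Z γ x) (hW : HolderAt W γ x) :
    HolderAt (fun y => Z y + W y) γ x := by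
  obtain ⟨P, C, δ, hC, hδ, hd, hP⟩ := hZ
  obtain ⟨Q, D, ε, hD, hε, he, hQ⟩ := hW
  refine ⟨P + Q, C + D, min δ ε, by positivity, by positivity, ?_, fun y hy => ?_⟩
  · rcases hd with rfl | hd
    · simpa using he
    · rcases he with rfl | he
      · right; simpa using hd
      · right
        refine lt_of_le_of_lt (Nat.cast_le.2 (Polynomial.natDegree_add_le P Q)) ?_
        rw [Nat.cast_max]
        exact max_lt hd he
  · have h1 := hP y (hy.trans_le (min_le_left _ _))
    have h2 := hQ y (hy.trans_le (min_le_right _ _))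
    rw [Polynomial.eval_add, add_mul]
    refine le_trans (le_of_eq ?_) ((abs_add_le _ _).trans (add_le_add h1 h2))
    congr 1; ring

lemma HolderAt.continuousAt {Z : ℝ → ℝ} {γ x : ℝ} (h : HolderAt Z γ x) (hγ : 0 < γ) :
    ContinuousAt Z x := by
  obtain ⟨P, C, δ, hC, hδ, -, hP⟩ := h
  have h0 : Z x = P.eval 0 := by
    have := hP x (by simpa using hδ)
    rw [sub_self, abs_zero, Real.zero_rpow hγ.ne', mul_zero] at this
    linarith [abs_nonpos_iff.1 this]
  have hlim : Tendsto (fun y => C * |y - x| ^ γ) (𝓝 x) (𝓝 0) := by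
    have : ContinuousAt (fun y : ℝ => C * |y - x| ^ γ) x := by
      refine continuousAt_const.mul (ContinuousAt.rpow_const ?_ (Or.inr hγ.le))
      fun_prop
    simpa [ContinuousAt, Real.zero_rpow hγ.ne'] using this
  have h1 : Tendsto (fun y => Z y - P.eval (y - x)) (𝓝 x) (𝓝 0) := by
    refine squeeze_zero_norm' ?_ hlim
    filter_upwards [Metric.ball_mem_nhds x hδ] with y hy
    exact hP y (by simpa [Real.dist_eq] using hy)
  have h2 : Tendsto (fun y => P.eval (y - x)) (𝓝 x) (𝓝 (Z x)) := by
    have : Continuous fun y : ℝ => P.eval (y - x) := P.continuous.comp (by fun_prop)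
    have := this.tendsto x
    rwa [sub_self, ← h0] at this
  have := h1.add h2
  simpa [ContinuousAt] using this

lemma le_holderExp {Z : ℝ → ℝ} {x h : ℝ} (hh : 0 < h)
    (H : ∀ γ, 0 < γ → γ < h → HolderAt Z γ x) : (h : EReal) ≤ holderExp Z x := by
  refine le_of_forall_lt fun c hc => ?_
  obtain ⟨r, hcr, hrh⟩ := EReal.lt_iff_exists_real_btwn.1 hc
  have hrh' : r < h := by exact_mod_cast hrh
  refine hcr.trans_le (le_trans (EReal.coe_le_coe_iff.2 (le_max_left r (h / 2))) ?_)
  have hpos : 0 < max r (h / 2) := lt_max_of_lt_right (by positivity)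
  exact le_sSup ⟨_, hpos.le, H _ hpos (max_lt hrh' (by linarith)), rfl⟩

lemma holderExp_le {Z : ℝ → ℝ} {x h : ℝ} (H : ∀ γ, 0 ≤ γ → HolderAt Z γ x → γ ≤ h) :
    holderExp Z x ≤ h := by
  refine sSup_le ?_
  rintro _ ⟨γ, h0, hγ, rfl⟩
  exact EReal.coe_le_coe_iff.2 (H γ h0 hγ)

/-! ### Lacunary series of piecewise polynomial bumps -/

/-- The polynomial `t ^ N * (1 - t) ^ N`. -/
noncomputable def bumpPoly (N : ℕ) : Polynomial ℝ :=
  Polynomial.X ^ N * (1 - Polynomial.X) ^ N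

/-- The series `∑ₖ c(k, m) t ^ N (1 - t) ^ N`, where `B ^ k x` has integer part `m` and fractional
part `t`. -/
noncomputable def bumpSeries (B N : ℕ) (c : ℕ → ℤ → ℝ) (x : ℝ) : ℝ :=
  ∑' k : ℕ, c k ⌊(B : ℝ) ^ k * x⌋ * (bumpPoly N).eval (Int.fract ((B : ℝ) ^ k * x))

lemma bumpPoly_eval (N : ℕ) (t : ℝ) : (bumpPoly N).eval t = t ^ N * (1 - t) ^ N := by
  simp [bumpPoly]

lemma natDegree_bumpPoly_le (N : ℕ) : (bumpPoly N).natDegree ≤ 2 * N := by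
  unfold bumpPoly
  compute_degree
  omega

lemma bumpPoly_fract_nonneg (N : ℕ) (x : ℝ) : 0 ≤ (bumpPoly N).eval (Int.fract x) := by
  rw [bumpPoly_eval]
  have := Int.fract_nonneg x
  have := (Int.fract_lt_one x).le
  exact mul_nonneg (by positivity) (pow_nonneg (by linarith) _)

lemma bumpPoly_fract_le_one (N : ℕ) (x : ℝ) : (bumpPoly N).eval (Int.fract x) ≤ 1 := by
  rw [bumpPoly_eval]
  have := Int.fract_nonneg x
  have := (Int.fract_lt_one x).le
  exact mul_le_one₀ (pow_le_one₀ (by assumption) (by assumption)) (pow_nonneg (by linarith) _)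
    (pow_le_one₀ (by linarith) (by linarith))

lemma abs_bumpPoly_fract_le_one (N : ℕ) (x : ℝ) : |(bumpPoly N).eval (Int.fract x)| ≤ 1 := by
  rw [abs_of_nonneg (bumpPoly_fract_nonneg N x)]
  exact bumpPoly_fract_le_one N x

lemma hasSum_rpow_neg_mul {B : ℕ} (hB : 2 ≤ B) {σ : ℝ} (hσ : 0 < σ) :
    HasSum (fun k : ℕ => (B : ℝ) ^ (-((k : ℝ) * σ))) (1 - (B : ℝ) ^ (-σ))⁻¹ := by
  have hB1 : (1 : ℝ) < B := by exact_mod_cast hB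
  have h := hasSum_geometric_of_lt_one (Real.rpow_nonneg (by positivity : (0 : ℝ) ≤ B) (-σ))
    (Real.rpow_lt_one_of_one_lt_of_neg hB1 (by linarith))
  have heq : (fun k : ℕ => (B : ℝ) ^ (-((k : ℝ) * σ))) = fun k => ((B : ℝ) ^ (-σ)) ^ k := by
    funext k
    rw [← Real.rpow_natCast, ← Real.rpow_mul (by positivity)]
    congr 1; ring
  rwa [heq]

lemma summable_rpow_neg_mul {B : ℕ} (hB : 2 ≤ B) {σ : ℝ} (hσ : 0 < σ) :
    Summable (fun k : ℕ => (B : ℝ) ^ (-((k : ℝ) * σ))) := (hasSum_rpow_neg_mul hB hσ).summable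

lemma summable_bumpSeries {B N : ℕ} (hB : 2 ≤ B) {c : ℕ → ℤ → ℝ} {C η : ℝ} (hη : 0 < η)
    (hc : ∀ k m, |c k m| ≤ C * (B : ℝ) ^ (-((k : ℝ) * η))) (x : ℝ) :
    Summable fun k : ℕ =>
      c k ⌊(B : ℝ) ^ k * x⌋ * (bumpPoly N).eval (Int.fract ((B : ℝ) ^ k * x)) := by
  refine Summable.of_norm_bounded ((summable_rpow_neg_mul hB hη).mul_left C) fun k => ?_
  rw [Real.norm_eq_abs, abs_mul]
  calc _ ≤ |c k ⌊(B : ℝ) ^ k * x⌋| * 1 := by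
        gcongr
        exact abs_bumpPoly_fract_le_one N _
    _ ≤ _ := by rw [mul_one]; exact hc _ _

lemma bumpSeries_add {B N : ℕ} (hB : 2 ≤ B) {c d : ℕ → ℤ → ℝ} {C D η : ℝ} (hη : 0 < η)
    (hc : ∀ k m, |c k m| ≤ C * (B : ℝ) ^ (-((k : ℝ) * η)))
    (hd : ∀ k m, |d k m| ≤ D * (B : ℝ) ^ (-((k : ℝ) * η))) :
    bumpSeries B N (fun k m => c k m + d k m)
      = fun x => bumpSeries B N c x + bumpSeries B N d x := by
  funext x
  unfold bumpSeries
  rw [← (summable_bumpSeries hB hη hc x).tsum_add (summable_bumpSeries hB hη hd x)]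
  simp only [add_mul]

lemma holderAt_bumpSeries_of_local {B N : ℕ} (hB : 2 ≤ B) {c : ℕ → ℤ → ℝ} {C δ σ γ x : ℝ}
    (hδ : 0 < δ) (hσ : 0 < σ)
    (hc : ∀ y, |y - x| < δ → ∀ k : ℕ,
      |c k ⌊(B : ℝ) ^ k * y⌋| ≤ C * |y - x| ^ γ * (B : ℝ) ^ (-((k : ℝ) * σ))) :
    HolderAt (bumpSeries B N c) γ x := by
  have hS := hasSum_rpow_neg_mul hB hσ
  set S := (1 - (B : ℝ) ^ (-σ))⁻¹
  have hS0 : 0 ≤ S := hS.nonneg fun k => by positivity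
  refine ⟨0, |C| * S + 1, δ, by positivity, hδ, Or.inl rfl, fun y hy => ?_⟩
  rw [Polynomial.eval_zero, sub_zero]
  have key : |bumpSeries B N c y| ≤ C * |y - x| ^ γ * S := by
    refine (Real.norm_eq_abs _).symm.trans_le (tsum_of_norm_bounded (hS.mul_left _) fun k => ?_)
    rw [Real.norm_eq_abs, abs_mul]
    calc _ ≤ |c k ⌊(B : ℝ) ^ k * y⌋| * 1 := by
          gcongr
          exact abs_bumpPoly_fract_le_one N _
      _ ≤ _ := by rw [mul_one]; exact hc y hy k
  have h1 : 0 ≤ |y - x| ^ γ := by positivity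
  have h2 : C * (|y - x| ^ γ * S) ≤ |C| * (|y - x| ^ γ * S) :=
    mul_le_mul_of_nonneg_right (le_abs_self C) (by positivity)
  nlinarith

lemma exists_abs_taylor_bumpPoly_coeff_le (N : ℕ) :
    ∃ C : ℝ, 0 < C ∧ ∀ θ ∈ Icc (0 : ℝ) 1, ∀ i,
      |(Polynomial.taylor θ (bumpPoly N)).coeff i| ≤ C := by
  have h : ∀ i, ∃ C : ℝ, ∀ θ ∈ Icc (0 : ℝ) 1,
      ‖(Polynomial.hasseDeriv i (bumpPoly N)).eval θ‖ ≤ C := fun i =>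
    isCompact_Icc.exists_bound_of_continuousOn (Polynomial.continuous _).continuousOn
  choose D hD using h
  have hD0 : ∀ i, 0 ≤ D i := fun i => (norm_nonneg _).trans (hD i 0 (by simp))
  refine ⟨∑ i ∈ Finset.range (2 * N + 1), D i + 1,
    add_pos_of_nonneg_of_pos (Finset.sum_nonneg fun i _ => hD0 i) one_pos, fun θ hθ i => ?_⟩
  by_cases hi : i < 2 * N + 1
  · rw [Polynomial.taylor_coeff]
    refine (hD i θ hθ).trans ?_
    have := Finset.single_le_sum (fun i _ => hD0 i) (Finset.mem_range.2 hi)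
    linarith
  · rw [Polynomial.coeff_eq_zero_of_natDegree_lt, abs_zero]
    · exact add_nonneg (Finset.sum_nonneg fun i _ => hD0 i) zero_le_one
    · rw [Polynomial.natDegree_taylor]
      have := natDegree_bumpPoly_le N
      omega

lemma bumpPoly_fract_le_pow (N : ℕ) (v : ℝ) (j : ℤ) :
    (bumpPoly N).eval (Int.fract v) ≤ |v - j| ^ N := by
  rw [bumpPoly_eval]
  have h0 := Int.fract_nonneg v
  have h1 := (Int.fract_lt_one v).le
  have hv := Int.floor_add_fract v
  rcases le_or_gt j ⌊v⌋ with h | h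
  · have hj : (j : ℝ) ≤ ⌊v⌋ := by exact_mod_cast h
    calc _ ≤ Int.fract v ^ N * 1 := by
          gcongr
          exact pow_le_one₀ (by linarith) (by linarith)
      _ ≤ _ := by
          rw [mul_one]
          gcongr
          exact le_trans (by linarith) (le_abs_self _)
  · have hj : (⌊v⌋ : ℝ) + 1 ≤ j := by exact_mod_cast h
    calc _ ≤ 1 * (1 - Int.fract v) ^ N := by
          gcongr
          exact pow_le_one₀ (by linarith) (by linarith)
      _ ≤ _ := by
          rw [one_mul]
          have : 1 - Int.fract v ≤ |v - j| := le_trans (by linarith) (neg_le_abs _)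
          exact pow_le_pow_left₀ (by linarith) this _

/-- A uniform Taylor estimate for one level of the series. -/
lemma exists_taylor_remainder_le (N : ℕ) {γ : ℝ} (hγ : 0 < γ) (hγN : γ ≤ N) :
    ∃ C : ℝ, 0 < C ∧ ∀ (a : ℤ → ℝ) (A : ℝ), (∀ m, |a m| ≤ A) → ∀ u t : ℝ,
      |a ⌊u + t⌋ * (bumpPoly N).eval (Int.fract (u + t))
        - ∑ i ∈ Finset.range ⌈γ⌉₊,
          a ⌊u⌋ * (Polynomial.taylor (Int.fract u) (bumpPoly N)).coeff i * t ^ i|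
        ≤ C * A * |t| ^ γ := by
  obtain ⟨C₀, hC₀, hcoeff⟩ := exists_abs_taylor_bumpPoly_coeff_le N
  set p := ⌈γ⌉₊ with hp
  have hpN : p ≤ N := Nat.ceil_le.2 hγN
  have hp1 : 1 ≤ p := Nat.one_le_ceil_iff.2 hγ
  have hγp : γ ≤ p := Nat.le_ceil γ
  have hpγ : ((p - 1 : ℕ) : ℝ) ≤ γ := by
    have := Nat.ceil_lt_add_one hγ.le
    rw [Nat.cast_sub hp1]
    push_cast
    linarith
  refine ⟨1 + 2 ^ N + (2 * N + 1) * C₀, by positivity, fun a A ha u t => ?_⟩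
  have hA : 0 ≤ A := (abs_nonneg _).trans (ha 0)
  set θ := Int.fract u with hθ
  have hθ0 : 0 ≤ θ := Int.fract_nonneg u
  have hθ1 : θ < 1 := Int.fract_lt_one u
  have hu : (⌊u⌋ : ℝ) + θ = u := Int.floor_add_fract u
  set R := Polynomial.taylor θ (bumpPoly N) with hR
  have hRc : ∀ i, |R.coeff i| ≤ C₀ := hcoeff θ ⟨hθ0, hθ1.le⟩
  have htp : 0 ≤ |t| ^ γ := by positivity
  have hsum : ∑ i ∈ Finset.range p, a ⌊u⌋ * R.coeff i * t ^ i
      = a ⌊u⌋ * ∑ i ∈ Finset.range p, R.coeff i * t ^ i := by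
    rw [Finset.mul_sum]
    exact Finset.sum_congr rfl fun i _ => by ring
  rw [hsum]
  have hval : |a ⌊u + t⌋ * (bumpPoly N).eval (Int.fract (u + t))| ≤ A := by
    rw [abs_mul]
    exact (mul_le_mul (ha _) (abs_bumpPoly_fract_le_one N _) (abs_nonneg _) hA).trans
      (mul_one A).le
  rcases le_or_gt |t| 1 with ht | ht
  · have hpow : ∀ n : ℕ, p ≤ n → |t| ^ n ≤ |t| ^ γ := by
      intro n hn
      rcases (abs_nonneg t).eq_or_lt with h | h
      · rw [← h, zero_pow (by omega), Real.zero_rpow hγ.ne']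
      · rw [← Real.rpow_natCast]
        exact Real.rpow_le_rpow_of_exponent_ge h ht (hγp.trans (by exact_mod_cast hn))
    have hRt : R.eval t = (t + θ) ^ N * (1 - (t + θ)) ^ N := by
      rw [hR, Polynomial.taylor_eval, bumpPoly_eval]
    have htail : |R.eval t - ∑ i ∈ Finset.range p, R.coeff i * t ^ i|
        ≤ (2 * N + 1) * C₀ * |t| ^ γ := by
      have hdeg : R.natDegree < 2 * N + 1 := by
        rw [hR, Polynomial.natDegree_taylor]
        exact Nat.lt_succ_of_le (natDegree_bumpPoly_le N)
      rw [Polynomial.eval_eq_sum_range' hdeg,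
        ← Finset.sum_range_add_sum_Ico _ (by omega : p ≤ 2 * N + 1), add_sub_cancel_left]
      calc _ ≤ ∑ i ∈ Finset.Ico p (2 * N + 1), |R.coeff i * t ^ i| :=
            Finset.abs_sum_le_sum_abs _ _
        _ ≤ ∑ i ∈ Finset.Ico p (2 * N + 1), C₀ * |t| ^ γ := by
            refine Finset.sum_le_sum fun i hi => ?_
            rw [abs_mul, abs_pow]
            have h1 := hpow i (Finset.mem_Ico.1 hi).1
            exact mul_le_mul (hRc i) h1 (by positivity) hC₀.le
        _ ≤ _ := by
            rw [Finset.sum_const, nsmul_eq_mul, Nat.card_Ico, mul_assoc]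
            gcongr
            have : ((2 * N + 1 - p : ℕ) : ℝ) ≤ ((2 * N + 1 : ℕ) : ℝ) := by
              exact_mod_cast Nat.sub_le _ _
            push_cast at this
            exact this
    by_cases hcell : ⌊u + t⌋ = ⌊u⌋
    · have hf : Int.fract (u + t) = t + θ := by
        rw [Int.fract, hcell]
        linarith
      rw [hcell, hf, show (bumpPoly N).eval (t + θ) = R.eval t from
        (bumpPoly_eval N (t + θ)).trans hRt.symm, ← mul_sub, abs_mul]
      have := mul_le_mul (ha ⌊u⌋) htail (abs_nonneg _) hA
      refine this.trans ?_
      have : 0 ≤ A * |t| ^ γ * (1 + 2 ^ N) := by positivity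
      nlinarith
    · have hout : |(bumpPoly N).eval (Int.fract (u + t))| ≤ |t| ^ γ ∧
          |R.eval t| ≤ 2 ^ N * |t| ^ γ := by
        rw [abs_of_nonneg (bumpPoly_fract_nonneg N _), hRt, abs_mul, abs_pow, abs_pow]
        have htN := hpow N hpN
        have hle := abs_le.1 ht
        have hlo := abs_nonneg t
        rcases lt_or_gt_of_ne hcell with h | h
        · have h1 : u + t < ⌊u⌋ := Int.floor_lt.1 h
          have ht0 : t < 0 := by linarith
          have hneg := abs_of_neg ht0
          constructor
          · refine (bumpPoly_fract_le_pow N (u + t) ⌊u⌋).trans (le_trans ?_ htN)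
            gcongr 1
            rw [abs_of_neg (by linarith)]
            linarith
          · have e1 : |t + θ| ^ N ≤ |t| ^ N := by
              gcongr 1
              rw [abs_of_neg (by linarith)]
              linarith
            have e2 : |1 - (t + θ)| ^ N ≤ 2 ^ N := by
              gcongr 1
              rw [abs_le]; constructor <;> linarith
            calc _ ≤ |t| ^ N * 2 ^ N := mul_le_mul e1 e2 (by positivity) (by positivity)
              _ ≤ _ := by rw [mul_comm]; gcongr
        · have h1 : (⌊u⌋ : ℝ) + 1 ≤ u + t := by
            have : ⌊u⌋ + 1 ≤ ⌊u + t⌋ := h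
            have := Int.le_floor.1 this
            push_cast at this
            exact this
          have ht0 : 0 < t := by linarith
          have hpos := abs_of_pos ht0
          constructor
          · refine (bumpPoly_fract_le_pow N (u + t) (⌊u⌋ + 1)).trans (le_trans ?_ htN)
            gcongr 1
            push_cast
            rw [abs_of_nonneg (by linarith)]
            linarith
          · have e1 : |t + θ| ^ N ≤ 2 ^ N := by
              gcongr 1
              rw [abs_le]; constructor <;> linarith
            have e2 : |1 - (t + θ)| ^ N ≤ |t| ^ N := by
              gcongr 1
              rw [abs_of_nonpos (by linarith)]
              linarith
            exact (mul_le_mul e1 e2 (by positivity) (by positivity)).trans (by gcongr)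
      have hT : |∑ i ∈ Finset.range p, R.coeff i * t ^ i|
          ≤ (2 ^ N + (2 * N + 1) * C₀) * |t| ^ γ := by
        have := abs_sub_abs_le_abs_sub (∑ i ∈ Finset.range p, R.coeff i * t ^ i) (R.eval t)
        rw [abs_sub_comm] at this
        linarith [hout.2]
      calc _ ≤ _ := abs_sub _ _
        _ ≤ A * |t| ^ γ + A * ((2 ^ N + (2 * N + 1) * C₀) * |t| ^ γ) := by
            rw [abs_mul, abs_mul]
            exact add_le_add (mul_le_mul (ha _) hout.1 (abs_nonneg _) hA)
              (mul_le_mul (ha _) hT (abs_nonneg _) hA)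
        _ = _ := by ring
  · have h1 : 1 ≤ |t| ^ γ := Real.one_le_rpow ht.le hγ.le
    have hT : |∑ i ∈ Finset.range p, R.coeff i * t ^ i| ≤ (2 * N + 1) * C₀ * |t| ^ γ := by
      calc _ ≤ ∑ i ∈ Finset.range p, |R.coeff i * t ^ i| := Finset.abs_sum_le_sum_abs _ _
        _ ≤ ∑ i ∈ Finset.range p, C₀ * |t| ^ γ := by
            refine Finset.sum_le_sum fun i hi => ?_
            rw [abs_mul, abs_pow]
            have hi' : i ≤ p - 1 := by
              have := Finset.mem_range.1 hi
              omega
            have h2 : |t| ^ i ≤ |t| ^ γ := by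
              rw [← Real.rpow_natCast]
              refine Real.rpow_le_rpow_of_exponent_le ht.le (le_trans ?_ hpγ)
              exact_mod_cast hi'
            exact mul_le_mul (hRc i) h2 (by positivity) hC₀.le
        _ ≤ _ := by
            rw [Finset.sum_const, nsmul_eq_mul, Finset.card_range, mul_assoc]
            gcongr
            have : (p : ℝ) ≤ N := by exact_mod_cast hpN
            have : (0 : ℝ) ≤ N := by positivity
            linarith
    calc _ ≤ _ := abs_sub _ _
      _ ≤ A * |t| ^ γ + A * ((2 * N + 1) * C₀ * |t| ^ γ) := by
          refine add_le_add (hval.trans (le_mul_of_one_le_right hA h1)) ?_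
          rw [abs_mul]
          exact mul_le_mul (ha _) hT (abs_nonneg _) hA
      _ ≤ _ := by
          have : 0 ≤ A * |t| ^ γ * 2 ^ N := by positivity
          nlinarith

lemma holderAt_bumpSeries_of_uniform {B N : ℕ} (hB : 2 ≤ B) {c : ℕ → ℤ → ℝ} {C η γ : ℝ}
    (hγ : 0 < γ) (hγη : γ < η) (hγN : γ ≤ N)
    (hc : ∀ k m, |c k m| ≤ C * (B : ℝ) ^ (-((k : ℝ) * η))) (x : ℝ) :
    HolderAt (bumpSeries B N c) γ x := by
  obtain ⟨K, hK, hrem⟩ := exists_taylor_remainder_le N hγ hγN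
  obtain ⟨C₀, hC₀, hcoeff⟩ := exists_abs_taylor_bumpPoly_coeff_le N
  have hB0 : (0 : ℝ) < B := by positivity
  have hC : 0 ≤ C := by
    have := (abs_nonneg _).trans (hc 0 0)
    simpa using this
  have hη : 0 < η := hγ.trans hγη
  set p := ⌈γ⌉₊ with hp
  set d : ℕ → ℕ → ℝ := fun k i => c k ⌊(B : ℝ) ^ k * x⌋ *
    (Polynomial.taylor (Int.fract ((B : ℝ) ^ k * x)) (bumpPoly N)).coeff i with hd
  have hdk : ∀ k i, |d k i| ≤ C * C₀ * (B : ℝ) ^ (-((k : ℝ) * η)) := by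
    intro k i
    rw [hd, abs_mul]
    have := mul_le_mul (hc k ⌊(B : ℝ) ^ k * x⌋)
      (hcoeff (Int.fract ((B : ℝ) ^ k * x)) ⟨Int.fract_nonneg _, (Int.fract_lt_one _).le⟩ i)
      (abs_nonneg _) (by positivity)
    linarith
  have hsumm : ∀ i ∈ Finset.range p, Summable fun k => d k i * ((B : ℝ) ^ k) ^ i := by
    intro i hi
    have hi' : (i : ℝ) < η := (Nat.lt_ceil.1 (Finset.mem_range.1 hi)).trans hγη
    refine Summable.of_norm_bounded
      ((summable_rpow_neg_mul hB (sub_pos.2 hi')).mul_left (C * C₀)) fun k => ?_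
    rw [Real.norm_eq_abs, abs_mul, abs_of_nonneg (by positivity : (0 : ℝ) ≤ ((B : ℝ) ^ k) ^ i)]
    refine (mul_le_mul_of_nonneg_right (hdk k i) (by positivity)).trans (le_of_eq ?_)
    rw [mul_assoc, ← Real.rpow_natCast, ← Real.rpow_natCast, ← Real.rpow_mul hB0.le,
      ← Real.rpow_add hB0]
    congr 2; ring
  set P : Polynomial ℝ := ∑ i ∈ Finset.range p,
    Polynomial.C (∑' k, d k i * ((B : ℝ) ^ k) ^ i) * Polynomial.X ^ i with hP
  have hS := hasSum_rpow_neg_mul hB (sub_pos.2 hγη)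
  set S := (1 - (B : ℝ) ^ (-(η - γ)))⁻¹
  have hS0 : 0 ≤ S := hS.nonneg fun k => by positivity
  refine ⟨P, K * C * S + 1, 1, by positivity, one_pos, Or.inr ?_, fun y _ => ?_⟩
  · have hp1 : 1 ≤ p := Nat.one_le_ceil_iff.2 hγ
    have hdeg : P.natDegree ≤ p - 1 := by
      refine Polynomial.natDegree_sum_le_of_forall_le _ _ fun i hi => ?_
      refine (Polynomial.natDegree_C_mul_X_pow_le _ _).trans ?_
      have := Finset.mem_range.1 hi
      omega
    exact Nat.lt_ceil.1 (lt_of_le_of_lt hdeg (by omega))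
  · have hPe : P.eval (y - x)
        = ∑' k, ∑ i ∈ Finset.range p, d k i * ((B : ℝ) ^ k * (y - x)) ^ i := by
      rw [hP, Polynomial.eval_finsetSum, Summable.tsum_finsetSum]
      · refine Finset.sum_congr rfl fun i hi => ?_
        simp only [Polynomial.eval_mul, Polynomial.eval_C, Polynomial.eval_pow, Polynomial.eval_X]
        rw [← tsum_mul_right]
        exact tsum_congr fun k => by rw [mul_pow]; ring
      · intro i hi
        refine ((hsumm i hi).mul_right ((y - x) ^ i)).congr fun k => ?_
        rw [mul_pow]; ring
    have hsumP : Summable fun k => ∑ i ∈ Finset.range p, d k i * ((B : ℝ) ^ k * (y - x)) ^ i := by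
      refine summable_sum fun i hi => ?_
      refine ((hsumm i hi).mul_right ((y - x) ^ i)).congr fun k => ?_
      rw [mul_pow]; ring
    rw [hPe]
    unfold bumpSeries
    rw [← (summable_bumpSeries hB hη hc y).tsum_sub hsumP]
    have key := tsum_of_norm_bounded (f := fun k =>
      c k ⌊(B : ℝ) ^ k * y⌋ * (bumpPoly N).eval (Int.fract ((B : ℝ) ^ k * y))
        - ∑ i ∈ Finset.range p, d k i * ((B : ℝ) ^ k * (y - x)) ^ i)
      (hS.mul_left (K * C * |y - x| ^ γ)) fun k => ?_
    · rw [Real.norm_eq_abs] at key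
      refine key.trans ?_
      have : 0 ≤ |y - x| ^ γ := by positivity
      nlinarith
    · have h := hrem (c k) _ (hc k) ((B : ℝ) ^ k * x) ((B : ℝ) ^ k * (y - x))
      rw [show (B : ℝ) ^ k * x + (B : ℝ) ^ k * (y - x) = (B : ℝ) ^ k * y by ring] at h
      rw [Real.norm_eq_abs]
      refine h.trans (le_of_eq ?_)
      rw [abs_mul, abs_of_nonneg (by positivity : (0 : ℝ) ≤ (B : ℝ) ^ k),
        Real.mul_rpow (by positivity) (abs_nonneg _), ← Real.rpow_natCast,
        ← Real.rpow_mul hB0.le,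
        show -((k : ℝ) * (η - γ)) = -((k : ℝ) * η) + k * γ by ring, Real.rpow_add hB0]
      ring

lemma Polynomial.sum_choose_mul_eval_eq_zero {G : Polynomial ℝ} {M : ℕ} (hG : G.natDegree < M) :
    ∑ i ∈ Finset.range (M + 1), ((-1 : ℝ) ^ (M - i) * M.choose i) * G.eval (i : ℝ) = 0 := by
  have h := congrFun (Polynomial.fwdDiff_iter_eq_zero_of_degree_lt hG) 0
  rw [fwdDiff_iter_eq_sum_shift] at h
  simpa using h

/-- The term of level `j` of `bumpSeries` on the grid of mesh `B ^ (-(k+1))` starting just before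
`(m + 1) / B ^ k`, when `j < k`: it is polynomial in the grid index. -/
lemma exists_polynomial_bumpSeries_term {B N k j : ℕ} (hB : 2 * N + 2 ≤ B) (hjk : j < k)
    (c : ℕ → ℤ → ℝ) {m : ℤ} (hm : (B : ℤ) ∣ m) :
    ∃ G : Polynomial ℝ, G.natDegree ≤ 2 * N ∧ ∀ i ≤ 2 * N + 1,
      c j ⌊(B : ℝ) ^ j * ((m + 1 + ((i : ℝ) - 1) / B) / (B : ℝ) ^ k)⌋ *
        (bumpPoly N).eval (Int.fract ((B : ℝ) ^ j * ((m + 1 + ((i : ℝ) - 1) / B) / (B : ℝ) ^ k)))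
        = G.eval (i : ℝ) := by
  obtain ⟨m', rfl⟩ := hm
  have hB0 : (0 : ℝ) < B := by
    have : 0 < B := by omega
    exact_mod_cast this
  obtain ⟨l, rfl⟩ : ∃ l, k = j + (l + 1) := ⟨k - j - 1, by omega⟩
  set n : ℤ := m' / (B : ℤ) ^ l with hn
  have hBl : (0 : ℤ) < (B : ℤ) ^ l := by
    have : 0 < B := by omega
    positivity
  have h1 : n * (B : ℤ) ^ l ≤ m' := Int.ediv_mul_le _ hBl.ne'
  have h2 : m' + 1 ≤ (n + 1) * (B : ℤ) ^ l := Int.lt_ediv_add_one_mul_self _ hBl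
  have h1' : (n : ℝ) * (B : ℝ) ^ l ≤ m' := by exact_mod_cast h1
  have h2' : (m' : ℝ) + 1 ≤ (n + 1) * (B : ℝ) ^ l := by exact_mod_cast h2
  have hpos : (0 : ℝ) < (B : ℝ) ^ (l + 1) := by positivity
  have hred : ∀ v : ℝ, (B : ℝ) ^ j * (v / (B : ℝ) ^ (j + (l + 1))) = v / (B : ℝ) ^ (l + 1) := by
    intro v
    rw [pow_add]
    field_simp
  refine ⟨Polynomial.C (c j n) * (bumpPoly N).comp
    (Polynomial.C (((B : ℝ) * m' + 1 - 1 / B) / (B : ℝ) ^ (l + 1) - n)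
      + Polynomial.C (1 / B / (B : ℝ) ^ (l + 1)) * Polynomial.X), ?_, fun i hi => ?_⟩
  · refine (Polynomial.natDegree_C_mul_le _ _).trans (Polynomial.natDegree_comp_le.trans ?_)
    have hd : (Polynomial.C (((B : ℝ) * m' + 1 - 1 / B) / (B : ℝ) ^ (l + 1) - n)
      + Polynomial.C (1 / B / (B : ℝ) ^ (l + 1)) * Polynomial.X).natDegree ≤ 1 := by
      refine Polynomial.natDegree_add_le_of_degree_le
            ((Polynomial.natDegree_C _).trans_le zero_le_one) ?_
      exact (Polynomial.natDegree_C_mul_le _ _).trans Polynomial.natDegree_X_le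
    exact (Nat.mul_le_mul (natDegree_bumpPoly_le N) hd).trans (by simp)
  · rw [hred]
    push_cast
    have hi' : (i : ℝ) ≤ 2 * N + 1 := by exact_mod_cast hi
    have hi0 : (0 : ℝ) ≤ i := by positivity
    have hBN : (2 : ℝ) * N + 2 ≤ B := by exact_mod_cast hB
    have hN0 : (0 : ℝ) ≤ N := by positivity
    have hq : ((i : ℝ) - 1) / B < 1 := by
      rw [div_lt_one hB0]
      linarith
    have hq' : -1 ≤ ((i : ℝ) - 1) / B := by
      rw [le_div_iff₀ hB0]
      linarith
    have hfl : ⌊((B : ℝ) * m' + 1 + ((i : ℝ) - 1) / B) / (B : ℝ) ^ (l + 1)⌋ = n := by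
      rw [Int.floor_eq_iff, le_div_iff₀ hpos, div_lt_iff₀ hpos, pow_succ]
      constructor <;> nlinarith
    rw [Int.fract, hfl]
    simp only [Polynomial.eval_mul, Polynomial.eval_C, Polynomial.eval_comp, Polynomial.eval_add,
      Polynomial.eval_X]
    congr 2
    field_simp
    ring

/-- A pointwise Hölder condition forces the nearby coefficients of a bump series to be small. -/
lemma exists_abs_coeff_le_of_holderAt {B N : ℕ} (hN : 1 ≤ N) (hB : 2 * N + 2 ≤ B)
    {c : ℕ → ℤ → ℝ} (hc : ∀ k m, ¬ (B : ℤ) ∣ m → c k m = 0) {γ x : ℝ} (hγ : 0 ≤ γ)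
    (hγN : γ ≤ 2 * N + 1) (h : HolderAt (bumpSeries B N c) γ x) :
    ∃ (C : ℝ) (k₀ : ℕ), ∀ k ≥ k₀, ∀ m : ℤ, (B : ℤ) ∣ m → |(B : ℝ) ^ k * x - m| ≤ B →
      |c k m| ≤ C * (B : ℝ) ^ (-((k : ℝ) * γ)) := by
  obtain ⟨P, C, δ, hC, hδ, hP, hZ⟩ := h
  have hB1 : (1 : ℝ) < B := by
    have : 1 < B := by omega
    exact_mod_cast this
  have hB0 : (0 : ℝ) < B := by linarith
  obtain ⟨k₀, hk₀⟩ : ∃ k₀ : ℕ, ((B : ℝ) + 2) / δ < (B : ℝ) ^ k₀ :=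
    pow_unbounded_of_one_lt _ hB1
  set M := 2 * N + 1 with hM
  set s : ℝ := (bumpPoly N).eval (1 - 1 / (B : ℝ)) with hs
  have hinv : (0 : ℝ) < 1 / B ∧ 1 / (B : ℝ) < 1 := by
    refine ⟨by positivity, ?_⟩
    rw [div_lt_one hB0]
    exact hB1
  have hs0 : 0 < s := by
    rw [hs, bumpPoly_eval]
    have : 0 < 1 - 1 / (B : ℝ) := by linarith [hinv.2]
    have : 0 < 1 - (1 - 1 / (B : ℝ)) := by linarith [hinv.1]
    positivity
  set W : ℝ := ∑ i ∈ Finset.range (M + 1), (M.choose i : ℝ) with hW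
  refine ⟨W * (C * ((B : ℝ) + 2) ^ γ) / s, k₀, fun k hk m hm hx => ?_⟩
  have hBN : (2 : ℝ) * N + 2 ≤ B := by exact_mod_cast hB
  set z : ℕ → ℝ := fun i => (m + 1 + ((i : ℝ) - 1) / B) / (B : ℝ) ^ k with hz
  have hzk : ∀ i, (B : ℝ) ^ k * z i = m + 1 + ((i : ℝ) - 1) / B := by
    intro i
    simp only [hz]
    field_simp
  have hbd : ∀ i ≤ M, -1 ≤ ((i : ℝ) - 1) / B ∧ ((i : ℝ) - 1) / B < 1 := by
    intro i hi
    have hi' : (i : ℝ) ≤ 2 * N + 1 := by exact_mod_cast hi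
    have hi0 : (0 : ℝ) ≤ i := by positivity
    rw [le_div_iff₀ hB0, div_lt_one hB0]
    constructor <;> linarith
  have hdist : ∀ i ≤ M, |z i - x| ≤ ((B : ℝ) + 2) / (B : ℝ) ^ k := by
    intro i hi
    rw [le_div_iff₀ (by positivity), ← abs_of_pos (by positivity : (0 : ℝ) < (B : ℝ) ^ k),
      ← abs_mul, sub_mul, mul_comm (z i), hzk]
    have := hbd i hi
    rw [abs_le] at hx ⊢
    constructor <;> linarith
  have hdist' : ∀ i ≤ M, |z i - x| < δ := by
    intro i hi
    refine (hdist i hi).trans_lt ?_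
    rw [div_lt_comm₀ (by positivity) hδ]
    exact hk₀.trans_le (pow_le_pow_right₀ hB1.le hk)
  have hG : ∀ j, ∃ G : Polynomial ℝ, G.natDegree ≤ 2 * N ∧ (j < k → ∀ i ≤ 2 * N + 1,
      c j ⌊(B : ℝ) ^ j * z i⌋ * (bumpPoly N).eval (Int.fract ((B : ℝ) ^ j * z i))
        = G.eval (i : ℝ)) := by
    intro j
    by_cases hj : j < k
    · obtain ⟨G, h1, h2⟩ := exists_polynomial_bumpSeries_term hB hj c hm
      exact ⟨G, h1, fun _ => h2⟩
    · exact ⟨0, by simp, fun h => absurd h hj⟩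
  choose G hGd hGe using hG
  set L : Polynomial ℝ := Polynomial.C ((m + 1 - 1 / B) / (B : ℝ) ^ k - x)
      + Polynomial.C (1 / B / (B : ℝ) ^ k) * Polynomial.X with hL
  have hLe : ∀ i : ℕ, L.eval (i : ℝ) = z i - x := by
    intro i
    simp only [hL, hz, Polynomial.eval_add, Polynomial.eval_C, Polynomial.eval_mul,
      Polynomial.eval_X]
    field_simp
    ring
  set H : Polynomial ℝ := ∑ j ∈ Finset.range k, G j - P.comp L with hH
  have hHd : H.natDegree < M := by
    refine Nat.lt_succ_of_le ((Polynomial.natDegree_sub_le_of_le (m := 2 * N) (n := 2 * N)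
      ?_ ?_).trans (max_self _).le)
    · exact Polynomial.natDegree_sum_le_of_forall_le _ _ fun j _ => hGd j
    · rcases hP with rfl | hP
      · simp
      · have hLd : L.natDegree ≤ 1 := by
          refine Polynomial.natDegree_add_le_of_degree_le
            ((Polynomial.natDegree_C _).trans_le zero_le_one) ?_
          exact (Polynomial.natDegree_C_mul_le _ _).trans Polynomial.natDegree_X_le
        refine Polynomial.natDegree_comp_le.trans ((Nat.mul_le_mul_left _ hLd).trans ?_)
        have : (P.natDegree : ℝ) < (2 * N + 1 : ℕ) := by push_cast; linarith
        have : P.natDegree < 2 * N + 1 := by exact_mod_cast this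
        omega
  have hlevel : ∀ i ≤ M, c k ⌊(B : ℝ) ^ k * z i⌋ *
      (bumpPoly N).eval (Int.fract ((B : ℝ) ^ k * z i)) = if i = 0 then c k m * s else 0 := by
    intro i hi
    rw [hzk]
    rcases Nat.eq_zero_or_pos i with rfl | hi0
    · have hfl : ⌊(m : ℝ) + 1 + (((0 : ℕ) : ℝ) - 1) / B⌋ = m := by
        rw [Int.floor_eq_iff]
        push_cast
        have : ((0 : ℝ) - 1) / B = -(1 / B) := by ring
        rw [this]
        constructor <;> linarith [hinv.1, hinv.2]
      rw [Int.fract, hfl, if_pos rfl, hs]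
      congr 2
      push_cast
      ring
    · have hi1 : (1 : ℝ) ≤ i := by exact_mod_cast hi0
      have hfl : ⌊(m : ℝ) + 1 + ((i : ℝ) - 1) / B⌋ = m + 1 := by
        rw [Int.floor_eq_iff]
        push_cast
        have := (hbd i hi).2
        have : 0 ≤ ((i : ℝ) - 1) / B := div_nonneg (by linarith) hB0.le
        constructor <;> linarith
      rw [hfl, hc k (m + 1), zero_mul, if_neg (by omega)]
      intro hd
      have := (Int.dvd_add_right hm).1 hd
      have := Int.le_of_dvd one_pos this
      omega
  have hval : ∀ i ≤ M, bumpSeries B N c (z i) - P.eval (z i - x)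
      = H.eval (i : ℝ) + if i = 0 then c k m * s else 0 := by
    intro i hi
    have hser : bumpSeries B N c (z i) = ∑ j ∈ Finset.range (k + 1),
        c j ⌊(B : ℝ) ^ j * z i⌋ * (bumpPoly N).eval (Int.fract ((B : ℝ) ^ j * z i)) := by
      refine tsum_eq_sum fun j hj => ?_
      obtain ⟨l, rfl⟩ : ∃ l, j = k + (l + 1) := by
        rw [Finset.mem_range] at hj
        exact ⟨j - k - 1, by omega⟩
      have : (B : ℝ) ^ (k + (l + 1)) * z i = (((B : ℤ) ^ l * (B * (m + 1) + (i - 1)) : ℤ) : ℝ) := by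
        rw [pow_add, pow_succ, show (B : ℝ) ^ k * ((B : ℝ) ^ l * B) * z i
          = (B : ℝ) ^ l * B * ((B : ℝ) ^ k * z i) by ring, hzk]
        push_cast
        field_simp
      rw [this, Int.fract_intCast, bumpPoly_eval, zero_pow (by omega), zero_mul, mul_zero]
    rw [hser, Finset.sum_range_succ, hlevel i hi, hH, Polynomial.eval_sub,
      Polynomial.eval_finsetSum, Polynomial.eval_comp, hLe,
      Finset.sum_congr rfl fun j hj => hGe j (Finset.mem_range.1 hj) i hi]
    ring
  have hdiff : ∑ i ∈ Finset.range (M + 1), ((-1 : ℝ) ^ (M - i) * M.choose i) *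
      (bumpSeries B N c (z i) - P.eval (z i - x)) = (-1) ^ M * (c k m * s) := by
    rw [Finset.sum_congr rfl fun i hi => by
      rw [hval i (Nat.lt_succ_iff.1 (Finset.mem_range.1 hi)), mul_add],
      Finset.sum_add_distrib, Polynomial.sum_choose_mul_eval_eq_zero hHd, zero_add,
      Finset.sum_eq_single 0]
    · simp
    · intro i _ hi
      simp [hi]
    · simp
  have hle : |c k m| * s ≤ W * (C * (((B : ℝ) + 2) / (B : ℝ) ^ k) ^ γ) := by
    have h1 : |(-1) ^ M * (c k m * s)| = |c k m| * s := by
      rw [abs_mul, abs_pow, abs_neg, abs_one, one_pow, one_mul, abs_mul, abs_of_pos hs0]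
    rw [← h1, ← hdiff, hW, Finset.sum_mul]
    refine (Finset.abs_sum_le_sum_abs _ _).trans (Finset.sum_le_sum fun i hi => ?_)
    have hi' := Nat.lt_succ_iff.1 (Finset.mem_range.1 hi)
    rw [abs_mul, abs_mul, abs_pow, abs_neg, abs_one, one_pow, one_mul, Nat.abs_cast]
    gcongr
    refine (hZ _ (hdist' i hi')).trans ?_
    gcongr
    exact hdist i hi'
  rw [div_mul_eq_mul_div, le_div_iff₀ hs0]
  refine hle.trans (le_of_eq ?_)
  rw [Real.div_rpow (by positivity) (by positivity), ← Real.rpow_natCast, ← Real.rpow_mul hB0.le,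
    Real.rpow_neg hB0.le]
  ring

namespace Real

lemma ofDigits_eq_head_add {b : ℕ} (a : ℕ → Fin b) :
    ofDigits a = ((a 0 : ℕ) + ofDigits (fun i => a (i + 1))) / b := by
  rw [ofDigits_eq_sum_add_ofDigits a 1]
  simp [ofDigitsTerm]
  ring

lemma ofDigits_shift_eq {b : ℕ} (a : ℕ → Fin b) (n : ℕ) :
    ofDigits (fun i => a (i + n)) = ((a n : ℕ) + ofDigits (fun i => a (i + (n + 1)))) / b := by
  rw [ofDigits_eq_head_add]
  simp [add_comm, add_left_comm]

lemma pow_mul_ofDigits {b : ℕ} (hb : 0 < b) (a : ℕ → Fin b) (n : ℕ) :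
    ∃ p : ℤ, (b : ℝ) ^ n * ofDigits a = p + ofDigits (fun i => a (i + n)) := by
  have hb' : (0 : ℝ) < b := by exact_mod_cast hb
  induction n with
  | zero => exact ⟨0, by simp⟩
  | succ n ih =>
    obtain ⟨p, hp⟩ := ih
    refine ⟨b * p + (a n : ℕ), ?_⟩
    rw [pow_succ', mul_assoc, hp, ofDigits_shift_eq]
    push_cast
    field_simp
    ring

lemma eq_of_ofDigits_two_eq_zero {w : ℕ → Fin 2} (h : ofDigits w = 0) (n : ℕ) : w n = 0 := by
  have key : ∀ n, ofDigits (fun i => w (i + n)) = 0 := by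
    intro n
    induction n with
    | zero => simpa using h
    | succ n ih =>
      rw [ofDigits_shift_eq] at ih
      have := ofDigits_nonneg (fun i => w (i + (n + 1)))
      have : (0 : ℝ) ≤ (w n : ℕ) := by positivity
      push_cast at ih
      linarith
  have h1 := key n
  rw [ofDigits_shift_eq, key (n + 1)] at h1
  have : ((w n : ℕ) : ℝ) = 0 := by push_cast at h1; linarith
  exact Fin.ext (Nat.cast_eq_zero.1 this)

lemma eq_of_ofDigits_two_eq_one {w : ℕ → Fin 2} (h : ofDigits w = 1) (n : ℕ) : w n = 1 := by
  have hw : ∀ n, ((w n : ℕ) : ℝ) ≤ 1 := fun n => by exact_mod_cast Nat.lt_succ_iff.1 (w n).2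
  have key : ∀ n, ofDigits (fun i => w (i + n)) = 1 := by
    intro n
    induction n with
    | zero => simpa using h
    | succ n ih =>
      rw [ofDigits_shift_eq] at ih
      have := ofDigits_le_one (fun i => w (i + (n + 1)))
      have := hw n
      push_cast at ih
      linarith
  have h1 := key n
  rw [ofDigits_shift_eq, key (n + 1)] at h1
  have : ((w n : ℕ) : ℝ) = 1 := by push_cast at h1; linarith
  exact Fin.ext (by exact_mod_cast this)

lemma eq_of_forall_lt_of_ofDigits_two_eq {e e' : ℕ → Fin 2} {n : ℕ} (hlt : ∀ i < n, e i = e' i)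
    (hn : e n = 0) (hn' : e' n = 1) (h : ofDigits e = ofDigits e') (i : ℕ) (hi : n < i) :
    e i = 1 ∧ e' i = 0 := by
  rw [ofDigits_eq_sum_add_ofDigits e n, ofDigits_eq_sum_add_ofDigits e' n,
    Finset.sum_congr rfl fun i hi => by
      rw [ofDigitsTerm, hlt i (Finset.mem_range.1 hi), ← ofDigitsTerm], add_right_inj] at h
  have h' := mul_left_cancel₀ (by positivity) h
  rw [ofDigits_shift_eq, ofDigits_shift_eq e', hn, hn'] at h'
  have h1 := ofDigits_le_one (fun i => e (i + (n + 1)))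
  have h2 := ofDigits_nonneg (fun i => e' (i + (n + 1)))
  simp only [Fin.val_zero, Fin.val_one, Nat.cast_zero, Nat.cast_one, Nat.cast_ofNat] at h'
  obtain ⟨j, rfl⟩ : ∃ j, i = j + (n + 1) := ⟨i - (n + 1), by omega⟩
  exact ⟨eq_of_ofDigits_two_eq_one (w := fun i => e (i + (n + 1))) (by linarith) j,
    eq_of_ofDigits_two_eq_zero (w := fun i => e' (i + (n + 1))) (by linarith) j⟩

lemma countable_ofDigits_two_fiber (τ : ℝ) : {e : ℕ → Fin 2 | ofDigits e = τ}.Countable := by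
  rcases Set.eq_empty_or_nonempty {e : ℕ → Fin 2 | ofDigits e = τ} with h | ⟨e₀, he₀⟩
  · rw [h]
    exact Set.countable_empty
  refine ((Set.countable_singleton e₀).union (Set.countable_range fun n : ℕ => fun i : ℕ =>
    if i < n then e₀ i else if i = n then 1 - e₀ n else e₀ n)).mono fun e he => ?_
  by_cases hee : e = e₀
  · exact Or.inl hee
  refine Or.inr ?_
  have hex : ∃ n, e n ≠ e₀ n := by
    by_contra! hcon
    exact hee (funext hcon)
  refine ⟨Nat.find hex, funext fun i => ?_⟩
  have hn := Nat.find_spec hex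
  have hlt : ∀ i < Nat.find hex, e i = e₀ i := fun i hi => not_not.1 (Nat.find_min hex hi)
  generalize Nat.find hex = n at hn hlt
  have heq : ofDigits e = ofDigits e₀ := he.trans he₀.symm
  have hcase : (e n = 0 ∧ e₀ n = 1) ∨ (e n = 1 ∧ e₀ n = 0) := by
    generalize e n = p at hn
    generalize e₀ n = q at hn
    revert p q
    decide
  rcases lt_trichotomy i n with hi | rfl | hi
  · simp [hi, hlt i hi]
  · rcases hcase with ⟨h1, h2⟩ | ⟨h1, h2⟩ <;> simp [h1, h2]
  · rcases hcase with ⟨h1, h2⟩ | ⟨h1, h2⟩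
    · have := eq_of_forall_lt_of_ofDigits_two_eq hlt h1 h2 heq i hi
      simp [hi.not_gt, hi.ne', this.1, h2]
    · have := eq_of_forall_lt_of_ofDigits_two_eq (fun i hi => (hlt i hi).symm) h2 h1 heq.symm i hi
      simp [hi.not_gt, hi.ne', this.2, h2]

end Real

lemma dimH_range_le_of_forall_abs_sub_le {ι : Type*} [Fintype ι]
    (f : (ℕ → ι) → ℝ) {Q : ℝ}
    (hQ : 1 < Q) (hf : ∀ n s t, (∀ i < n, s i = t i) → |f s - f t| ≤ (Q ^ n)⁻¹) (d : NNReal)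
    (hcard : (Fintype.card ι : ℝ) ≤ Q ^ (d : ℝ)) : dimH (range f) ≤ d := by
  refine dimH_le_of_hausdorffMeasure_ne_top ?_
  have hQ0 : 0 < Q := by linarith
  set D : (n : ℕ) → (Fin n → ι) → Set ℝ := fun n v => f '' {s | ∀ i : Fin n, s i = v i} with hD
  have hdiam : ∀ n v, ediam (D n v) ≤ ENNReal.ofReal ((Q⁻¹) ^ n) := by
    intro n v
    refine Metric.ediam_le ?_
    rintro _ ⟨s, hs, rfl⟩ _ ⟨t, ht, rfl⟩
    rw [edist_dist, Real.dist_eq, inv_pow]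
    exact ENNReal.ofReal_le_ofReal (hf n s t fun i hi => (hs ⟨i, hi⟩).trans (ht ⟨i, hi⟩).symm)
  have hlim : Tendsto (fun n : ℕ => ENNReal.ofReal ((Q⁻¹) ^ n)) atTop (𝓝 0) := by
    rw [← ENNReal.ofReal_zero]
    exact ENNReal.tendsto_ofReal
      (tendsto_pow_atTop_nhds_zero_of_lt_one (by positivity) (inv_lt_one_of_one_lt₀ hQ))
  have hle := Measure.hausdorffMeasure_le_liminf_sum (ι := fun n => Fin n → ι) (d : ℝ) (range f)
    (l := atTop) (fun n => ENNReal.ofReal ((Q⁻¹) ^ n)) hlim D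
    (Eventually.of_forall fun n v => hdiam n v) (Eventually.of_forall fun n => by
      rintro _ ⟨s, rfl⟩
      exact mem_iUnion.2 ⟨fun i => s i, s, fun i => rfl, rfl⟩)
  refine ne_top_of_le_ne_top ENNReal.one_ne_top (hle.trans ?_)
  refine liminf_le_of_frequently_le' (Frequently.of_forall fun n => ?_)
  calc ∑ v : Fin n → ι, ediam (D n v) ^ (d : ℝ)
      ≤ ∑ v : Fin n → ι, ENNReal.ofReal ((Q⁻¹) ^ n) ^ (d : ℝ) := by
        gcongr with v
        exact hdiam n v
    _ = ENNReal.ofReal (((Fintype.card ι : ℝ) * (Q ^ (d : ℝ))⁻¹) ^ n) := by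
        rw [Finset.sum_const, Finset.card_univ, nsmul_eq_mul, Fintype.card_fun, Fintype.card_fin,
          ENNReal.ofReal_rpow_of_nonneg (by positivity) d.coe_nonneg, ← ENNReal.ofReal_natCast,
          ← ENNReal.ofReal_mul (by positivity)]
        congr 1
        push_cast
        rw [mul_pow, ← Real.rpow_natCast, ← Real.rpow_natCast, ← Real.rpow_natCast,
          ← Real.rpow_mul (by positivity), ← Real.inv_rpow hQ0.le,
          ← Real.rpow_mul (by positivity), mul_comm (n : ℝ)]
    _ ≤ 1 := by
        rw [← ENNReal.ofReal_one]
        refine ENNReal.ofReal_le_ofReal (pow_le_one₀ (by positivity) ?_)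
        rw [← div_eq_mul_inv]
        exact div_le_one_of_le₀ hcard (by positivity)

namespace Real

lemma ofDigits_mem_Icc_of_forall {Q p q : ℕ} {D : ℕ → Fin Q} (hp : ∀ i, p ≤ (D i : ℕ))
    (hq : ∀ i, (D i : ℕ) < q) : ofDigits D ∈ Icc ((p : ℝ) / Q) ((q : ℝ) / Q) := by
  have hQ : (0 : ℝ) < Q := by exact_mod_cast Fin.pos (D 0)
  have h0 := ofDigits_nonneg (fun i => D (i + 1))
  have h1 := ofDigits_le_one (fun i => D (i + 1))
  have hp' : (p : ℝ) ≤ (D 0 : ℕ) := by exact_mod_cast hp 0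
  have hq' : ((D 0 : ℕ) : ℝ) + 1 ≤ q := by exact_mod_cast hq 0
  rw [ofDigits_eq_head_add]
  constructor <;> gcongr <;> linarith

lemma inv_le_abs_ofDigits_sub {Q q n : ℕ} (hq : 2 * q ≤ Q) {D D' : ℕ → Fin Q}
    (hD : ∀ i, (D i : ℕ) < q) (hD' : ∀ i, (D' i : ℕ) < q) (hlt : ∀ i < n, D i = D' i)
    (hn : D n ≠ D' n) : (2 * (Q : ℝ) ^ (n + 1))⁻¹ ≤ |ofDigits D - ofDigits D'| := by
  have hQ : (0 : ℝ) < Q := by exact_mod_cast Fin.pos (D 0)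
  have hsum : ∑ i ∈ Finset.range n, ofDigitsTerm D i = ∑ i ∈ Finset.range n, ofDigitsTerm D' i :=
    Finset.sum_congr rfl fun i hi => by
      rw [ofDigitsTerm, hlt i (Finset.mem_range.1 hi), ← ofDigitsTerm]
  rw [ofDigits_eq_sum_add_ofDigits D n, ofDigits_eq_sum_add_ofDigits D' n, hsum,
    add_sub_add_left_eq_sub, ← mul_sub, abs_mul, abs_of_pos (by positivity), ofDigits_shift_eq,
    ofDigits_shift_eq D', ← sub_div, abs_div, abs_of_pos hQ]
  have hr : (q : ℝ) / Q ≤ 1 / 2 := by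
    rw [div_le_iff₀ hQ]
    have : 2 * (q : ℝ) ≤ Q := by exact_mod_cast hq
    linarith
  have h1 := ofDigits_mem_Icc_of_forall (D := fun i => D (i + (n + 1))) (p := 0)
    (fun _ => Nat.zero_le _) fun i => hD _
  have h2 := ofDigits_mem_Icc_of_forall (D := fun i => D' (i + (n + 1))) (p := 0)
    (fun _ => Nat.zero_le _) fun i => hD' _
  rw [Nat.cast_zero, zero_div] at h1 h2
  set r := ofDigits fun i => D (i + (n + 1))
  set r' := ofDigits fun i => D' (i + (n + 1))
  have hne : (D n : ℕ) ≠ (D' n : ℕ) := fun h => hn (Fin.ext h)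
  have habs : 1 / 2 ≤ |((D n : ℕ) : ℝ) + r - ((D' n : ℕ) + r')| := by
    rcases lt_or_gt_of_ne hne with h | h
    · have : ((D n : ℕ) : ℝ) + 1 ≤ (D' n : ℕ) := by exact_mod_cast h
      rw [abs_sub_comm]
      exact le_trans (by linarith [h1.1, h1.2, h2.1, h2.2]) (le_abs_self _)
    · have : ((D' n : ℕ) : ℝ) + 1 ≤ (D n : ℕ) := by exact_mod_cast h
      exact le_trans (by linarith [h1.1, h1.2, h2.1, h2.2]) (le_abs_self _)
  calc (2 * (Q : ℝ) ^ (n + 1))⁻¹ = ((Q : ℝ) ^ n)⁻¹ * (1 / 2 / Q) := by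
        rw [pow_succ]
        field_simp
    _ ≤ _ := by gcongr

end Real

lemma exists_first_ne {ι : Type*} {s t : ℕ → ι} (h : s ≠ t) :
    ∃ n, s n ≠ t n ∧ ∀ i < n, s i = t i := by
  have hex : ∃ n, s n ≠ t n := by
    by_contra! hcon
    exact h (funext hcon)
  exact ⟨Nat.find hex, Nat.find_spec hex, fun i hi => not_not.1 (Nat.find_min hex hi)⟩

lemma ofDigits_comp_injective {ι : Type*} {Q q : ℕ} (hq : 2 * q ≤ Q) {δ : ι → Fin Q}
    (hδ : Function.Injective δ) (hδq : ∀ i, (δ i : ℕ) < q) :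
    Function.Injective fun t : ℕ → ι => Real.ofDigits fun g => δ (t g) := by
  intro s t hst
  by_contra hne
  obtain ⟨n, hn, hlt⟩ := exists_first_ne hne
  have hQ : (0 : ℝ) < Q := by exact_mod_cast Fin.pos (δ (s 0))
  have h := Real.inv_le_abs_ofDigits_sub hq (D := fun g => δ (s g)) (D' := fun g => δ (t g))
    (fun i => hδq _) (fun i => hδq _) (fun i hi => by rw [hlt i hi]) (fun h => hn (hδ h))
  rw [sub_eq_zero.2 hst, abs_zero] at h
  exact absurd h (not_le.2 (by positivity))

lemma natCast_pow_rpow_div {B L F : ℕ} (hL : 0 < L) :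
    (((B ^ L : ℕ) : ℝ)) ^ ((F : ℝ) / L) = ((B ^ F : ℕ) : ℝ) := by
  push_cast
  rw [← Real.rpow_natCast, ← Real.rpow_mul (by positivity), mul_div_cancel₀ _ (by positivity),
    Real.rpow_natCast]

lemma dimH_range_ofDigits_castLE {B L F : ℕ} (hB : 2 ≤ B) (hF : F < L) (hle : B ^ F ≤ B ^ L) :
    dimH (range fun u : ℕ → Fin (B ^ F) => Real.ofDigits fun g => Fin.castLE hle (u g))
      = (((F : NNReal) / L : NNReal) : ℝ≥0∞) := by
  have hL : 0 < L := by omega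
  have hQ1 : (1 : ℝ) < ((B ^ L : ℕ) : ℝ) := by
    exact_mod_cast Nat.one_lt_pow hL.ne' (by omega)
  have hQ0 : (0 : ℝ) < ((B ^ L : ℕ) : ℝ) := by linarith
  set Y := fun u : ℕ → Fin (B ^ F) => Real.ofDigits fun g => Fin.castLE hle (u g) with hY
  refine le_antisymm ?_ ?_
  · refine dimH_range_le_of_forall_abs_sub_le Y hQ1 (fun n s t hst => ?_) _ ?_
    · exact Real.abs_ofDigits_sub_ofDigits_le fun i hi => by rw [hst i hi]
    · rw [NNReal.coe_div, NNReal.coe_natCast, NNReal.coe_natCast, natCast_pow_rpow_div hL,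
        Fintype.card_fin]
  · rcases Nat.eq_zero_or_pos F with rfl | hF0
    · simp
    have hR1 : 1 < B ^ F := Nat.one_lt_pow hF0.ne' (by omega)
    have hRQ : 2 * B ^ F ≤ B ^ L :=
      calc 2 * B ^ F ≤ B * B ^ F := Nat.mul_le_mul_right _ hB
        _ = B ^ (F + 1) := by ring
        _ ≤ B ^ L := Nat.pow_le_pow_right (by omega) hF
    have hcast : Function.Injective (Fin.castLE hle) := Fin.castLE_injective hle
    have hinj : Function.Injective Y := ofDigits_comp_injective hRQ hcast fun i => i.2
    have : Nonempty (Fin (B ^ F)) := ⟨⟨0, by omega⟩⟩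
    set φ : ℝ → ℝ := Real.ofDigits ∘ Function.invFun Y with hφ
    have hφY : ∀ u, φ (Y u) = Real.ofDigits u := fun u => by
      rw [hφ, Function.comp_apply, Function.leftInverse_invFun hinj]
    set d : NNReal := (F : NNReal) / L with hd
    have hd0 : 0 < d := by positivity
    have hdc : (d : ℝ) = (F : ℝ) / L := by rw [hd]; simp
    have hhol : HolderOnWith (Real.toNNReal ((2 * ((B ^ L : ℕ) : ℝ)) ^ (d : ℝ))) d φ (range Y) := by
      rintro _ ⟨u, rfl⟩ _ ⟨u', rfl⟩
      rw [hφY, hφY]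
      by_cases huu : u = u'
      · simp [huu]
      obtain ⟨n, hn, hlt⟩ := exists_first_ne huu
      have hsep : (2 * ((B ^ L : ℕ) : ℝ) ^ (n + 1))⁻¹ ≤ |Y u - Y u'| :=
        Real.inv_le_abs_ofDigits_sub hRQ (fun i => (u i).2) (fun i => (u' i).2)
        (fun i hi => by rw [hlt i hi]) (fun h => hn (hcast h))
      have hup := Real.abs_ofDigits_sub_ofDigits_le hlt
      rw [edist_dist, edist_dist, Real.dist_eq, Real.dist_eq,
        ENNReal.ofReal_rpow_of_nonneg (abs_nonneg _) d.coe_nonneg, ← ENNReal.ofReal.eq_def,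
        ← ENNReal.ofReal_mul (by positivity), ← Real.mul_rpow (by positivity) (abs_nonneg _)]
      refine ENNReal.ofReal_le_ofReal (hup.trans ?_)
      have heq : ((((B ^ F : ℕ) : ℝ)) ^ n)⁻¹ = ((((B ^ L : ℕ) : ℝ) ^ n)⁻¹) ^ (d : ℝ) := by
        rw [← natCast_pow_rpow_div hL, hdc, ← Real.rpow_natCast, ← Real.rpow_natCast,
          ← Real.rpow_mul hQ0.le, Real.inv_rpow (by positivity), ← Real.rpow_mul hQ0.le,
          mul_comm (n : ℝ)]
      rw [heq]
      refine Real.rpow_le_rpow (by positivity) ?_ d.coe_nonneg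
      calc (((B ^ L : ℕ) : ℝ) ^ n)⁻¹
          = 2 * ((B ^ L : ℕ) : ℝ) * (2 * ((B ^ L : ℕ) : ℝ) ^ (n + 1))⁻¹ := by
            rw [pow_succ]
            field_simp
        _ ≤ _ := by gcongr
    have himg : φ '' range Y = range (Real.ofDigits (b := B ^ F)) := by
      rw [← range_comp]
      exact congrArg range (funext hφY)
    have h1 : (1 : ℝ≥0∞) ≤ dimH (φ '' range Y) := by
      rw [himg]
      have hsub : Icc (0 : ℝ) 1 ⊆ range (Real.ofDigits (b := B ^ F)) := by
        intro y hy
        obtain ⟨w, -, hw⟩ := Real.ofDigits_SurjOn hR1 hy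
        exact ⟨w, hw⟩
      refine le_trans (le_of_eq ?_) (dimH_mono hsub)
      rw [Real.dimH_of_nonempty_interior (by simp)]
      simp
    have h2 := h1.trans (hhol.dimH_image_le hd0)
    rwa [ENNReal.le_div_iff_mul_le (Or.inl (by simpa using hd0.ne')) (Or.inl ENNReal.coe_ne_top),
      one_mul] at h2

lemma fract_pow_mul_ofDigits {Q p q : ℕ} (hq : q < Q) {D : ℕ → Fin Q} (hp : ∀ i, p ≤ (D i : ℕ))
    (hDq : ∀ i, (D i : ℕ) < q) (g : ℕ) :
    Int.fract ((Q : ℝ) ^ g * Real.ofDigits D) ∈ Icc ((p : ℝ) / Q) ((q : ℝ) / Q) := by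
  have hQ : (0 : ℝ) < Q := by exact_mod_cast Fin.pos (D 0)
  have h := Real.ofDigits_mem_Icc_of_forall (D := fun i => D (i + g)) (fun i => hp _)
    (fun i => hDq _)
  obtain ⟨n, hn⟩ := Real.pow_mul_ofDigits (Fin.pos (D 0)) D g
  have h1 : (q : ℝ) / Q < 1 := by
    rw [div_lt_one hQ]
    exact_mod_cast hq
  rw [hn, Int.fract_intCast_add, Int.fract_eq_self.2 ⟨Real.ofDigits_nonneg _, h.2.trans_lt h1⟩]
  exact h

/-- A homogeneous Cantor set with digits in base `B ^ L`, fibred over expansions in base `E`. -/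
lemma exists_cantor_fibered {B L F E : ℕ} (hB : 9 ≤ B) (hF : F < L) (hE0 : 0 < E) (hE2 : E ≤ 2)
    (hcount : ∀ τ, {e : ℕ → Fin E | Real.ofDigits e = τ}.Countable) :
    ∃ (K : Set ℝ) (θ : ℝ → ℝ), IsCompact K ∧ ContinuousOn θ K ∧
      θ '' K = range (Real.ofDigits (b := E)) ∧ K ⊆ Icc (2 / B : ℝ) (4 / B) ∧
      (∀ x ∈ K, ∀ g : ℕ, Int.fract ((B : ℝ) ^ (L * g) * x) ∈ Icc (2 / B : ℝ) (4 / B)) ∧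
      dimH K < 1 ∧
      ∀ τ ∈ θ '' K, dimH {x ∈ K | θ x = τ} = (((F : NNReal) / L : NNReal) : ℝ≥0∞) := by
  obtain ⟨M, rfl⟩ : ∃ M, L = M + 1 := ⟨L - 1, by omega⟩
  have hRM : B ^ F ≤ B ^ M := Nat.pow_le_pow_right (by omega) (by omega)
  have hM0 : 0 < B ^ M := Nat.pow_pos (by omega)
  have hBM : B ^ (M + 1) = B * B ^ M := by ring
  have h9 : 9 * B ^ M ≤ B ^ (M + 1) := by
    rw [hBM]
    exact Nat.mul_le_mul_right _ hB
  have hR0 : 0 < B ^ F := Nat.pow_pos (by omega)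
  have hdig : ∀ i : Fin E × Fin (B ^ F), 2 * B ^ M ≤ (2 + (i.1 : ℕ)) * B ^ M + i.2 ∧
      (2 + (i.1 : ℕ)) * B ^ M + i.2 < 4 * B ^ M := by
    intro i
    have h1 : (i.1 : ℕ) ≤ 1 := by have := i.1.2; omega
    have h2 := i.2.2
    have h3 : (i.1 : ℕ) * B ^ M ≤ 1 * B ^ M := Nat.mul_le_mul_right _ h1
    rw [add_mul]
    omega
  set δ : Fin E × Fin (B ^ F) → Fin (B ^ (M + 1)) := fun i =>
    ⟨(2 + (i.1 : ℕ)) * B ^ M + i.2, by have := (hdig i).2; omega⟩ with hδ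
  have hδinj : Function.Injective δ := by
    rintro ⟨e, u⟩ ⟨e', u'⟩ h
    have h' : (2 + (e : ℕ)) * B ^ M + u = (2 + (e' : ℕ)) * B ^ M + u' := congrArg Fin.val h
    have hu := u.2.trans_le hRM
    have hu' := u'.2.trans_le hRM
    have hee : (2 + (e : ℕ)) = 2 + (e' : ℕ) := by
      have h1 := congrArg (· / B ^ M) h'
      simpa [Nat.mul_add_div hM0, mul_comm _ (B ^ M), Nat.div_eq_of_lt hu,
        Nat.div_eq_of_lt hu'] using h1
    rw [hee] at h'
    exact Prod.ext (Fin.ext (by simp only; omega)) (Fin.ext (by simp only; omega))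
  set X : (ℕ → Fin E × Fin (B ^ F)) → ℝ := fun t => Real.ofDigits fun g => δ (t g) with hX
  have hXc : Continuous X := Real.continuous_ofDigits.comp
    (continuous_pi fun g => (continuous_of_discreteTopology (f := δ)).comp (continuous_apply g))
  have hXinj : Function.Injective X :=
    ofDigits_comp_injective (q := 4 * B ^ M) (by omega) hδinj fun i => (hdig i).2
  set T : (ℕ → Fin E × Fin (B ^ F)) → ℝ := fun t => Real.ofDigits fun g => (t g).1 with hT
  have hTc : Continuous T := Real.continuous_ofDigits.comp
    (continuous_pi fun g => continuous_fst.comp (continuous_apply g))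
  have : Nonempty (Fin E × Fin (B ^ F)) := ⟨⟨0, hE0⟩, ⟨0, hR0⟩⟩
  set θ : ℝ → ℝ := T ∘ Function.invFun X with hθ
  have hθX : ∀ t, θ (X t) = T t := fun t => by
    rw [hθ, Function.comp_apply, Function.leftInverse_invFun hXinj]
  have hBpos : (0 : ℝ) < B := by
    have : 0 < B := by omega
    exact_mod_cast this
  have hq2 : ((2 * B ^ M : ℕ) : ℝ) / ((B ^ (M + 1) : ℕ) : ℝ) = 2 / B := by
    push_cast
    rw [pow_succ]
    field_simp
  have hq4 : ((4 * B ^ M : ℕ) : ℝ) / ((B ^ (M + 1) : ℕ) : ℝ) = 4 / B := by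
    push_cast
    rw [pow_succ]
    field_simp
  have himg : θ '' range X = range (Real.ofDigits (b := E)) := by
    rw [← range_comp]
    ext y
    constructor
    · rintro ⟨t, rfl⟩
      exact ⟨fun g => (t g).1, (hθX t).symm⟩
    · rintro ⟨e, rfl⟩
      exact ⟨fun g => (e g, ⟨0, hR0⟩), hθX _⟩
  refine ⟨range X, θ, isCompact_range hXc, ?_, himg, ?_, ?_, ?_, ?_⟩
  · rw [continuousOn_iff_continuous_domRestrict]
    have hemb := (hXc.isClosedEmbedding hXinj).isEmbedding
    have : (range X).domRestrict θ = T ∘ hemb.toHomeomorph.symm := by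
      ext ⟨_, t, rfl⟩
      have h1 : hemb.toHomeomorph.symm ⟨X t, t, rfl⟩ = t :=
        hemb.toHomeomorph.symm_apply_eq.2 rfl
      exact (hθX t).trans (congrArg T h1.symm)
    rw [this]
    exact hTc.comp hemb.toHomeomorph.symm.continuous
  · rintro _ ⟨t, rfl⟩
    rw [← hq2, ← hq4]
    exact Real.ofDigits_mem_Icc_of_forall (fun i => (hdig _).1) (fun i => (hdig _).2)
  · rintro _ ⟨t, rfl⟩ g
    rw [← hq2, ← hq4, pow_mul, ← Nat.cast_pow]
    exact fract_pow_mul_ofDigits (by omega) (fun i => (hdig _).1) (fun i => (hdig _).2) g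
  · have hM1 : (0 : ℝ) < (M : ℝ) + 1 := by positivity
    obtain ⟨d, hd⟩ : ∃ d : NNReal, (d : ℝ) = ((M : ℝ) + 1 / 2) / (M + 1) :=
      ⟨NNReal.mk _ (by positivity), rfl⟩
    have hQ1 : (1 : ℝ) < ((B ^ (M + 1) : ℕ) : ℝ) := by
      exact_mod_cast Nat.one_lt_pow (by omega) (by omega)
    have hle : dimH (range X) ≤ d := by
      refine dimH_range_le_of_forall_abs_sub_le X hQ1 (fun n s t hst => ?_) _ ?_
      · exact Real.abs_ofDigits_sub_ofDigits_le fun i hi => by rw [hst i hi]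
      · have hQd : (((B ^ (M + 1) : ℕ) : ℝ)) ^ (d : ℝ) = (B : ℝ) ^ M * √(B : ℝ) := by
          rw [hd]
          push_cast
          rw [← Real.rpow_natCast, ← Real.rpow_mul hBpos.le, Real.sqrt_eq_rpow,
            ← Real.rpow_natCast, ← Real.rpow_add hBpos]
          congr 1
          push_cast
          field_simp
        rw [hQd, Fintype.card_prod, Fintype.card_fin, Fintype.card_fin]
        have h2 : (2 : ℝ) ≤ √(B : ℝ) := by
          refine Real.le_sqrt_of_sq_le ?_
          have : (9 : ℝ) ≤ B := by exact_mod_cast hB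
          linarith
        have h3 : ((E * B ^ F : ℕ) : ℝ) ≤ 2 * (B : ℝ) ^ M := by
          exact_mod_cast Nat.mul_le_mul hE2 hRM
        have h4 : (0 : ℝ) ≤ (B : ℝ) ^ M := by positivity
        nlinarith
    refine hle.trans_lt ?_
    rw [← ENNReal.coe_one, ENNReal.coe_lt_coe, ← NNReal.coe_lt_coe, hd, NNReal.coe_one, div_lt_one hM1]
    linarith
  · intro τ hτ
    have hle : B ^ F ≤ B ^ (M + 1) := by omega
    set v : (ℕ → Fin E) → ℝ := fun e => Real.ofDigits fun g => δ (e g, ⟨0, hR0⟩) with hv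
    set Y := fun u : ℕ → Fin (B ^ F) => Real.ofDigits fun g => Fin.castLE hle (u g) with hY
    have hXadd : ∀ t, X t = v (fun g => (t g).1) + Y (fun g => (t g).2) := by
      intro t
      simp only [hX, hv, hY, Real.ofDigits]
      rw [← Real.summable_ofDigitsTerm.tsum_add Real.summable_ofDigitsTerm]
      refine tsum_congr fun n => ?_
      simp only [Real.ofDigitsTerm, hδ, Fin.val_castLE]
      push_cast
      ring
    have hset : {x ∈ range X | θ x = τ}
        = ⋃ e ∈ {e : ℕ → Fin E | Real.ofDigits e = τ}, (fun y => v e + y) '' range Y := by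
      ext x
      simp only [mem_ofPred_eq, mem_iUnion, exists_prop, mem_image, mem_range]
      constructor
      · rintro ⟨⟨t, rfl⟩, ht⟩
        rw [hθX] at ht
        exact ⟨fun g => (t g).1, ht, _, ⟨fun g => (t g).2, rfl⟩, (hXadd t).symm⟩
      · rintro ⟨e, he, _, ⟨u, rfl⟩, rfl⟩
        have h1 := hXadd fun g => (e g, u g)
        refine ⟨⟨_, h1⟩, ?_⟩
        rw [← h1, hθX]
        exact he
    rw [hset, dimH_bUnion (hcount τ)]
    have hC : ∀ e, dimH ((fun y => v e + y) '' range Y)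
        = (((F : NNReal) / (M + 1 : ℕ) : NNReal) : ℝ≥0∞) := by
      intro e
      rw [← dimH_range_ofDigits_castLE (by omega) hF hle]
      exact (IsometryEquiv.addLeft (v e)).dimH_image _
    simp only [hC]
    have hne : {e : ℕ → Fin E | Real.ofDigits e = τ}.Nonempty := by
      rw [himg] at hτ
      exact hτ
    exact biSup_const hne

lemma exists_cantor {B L F : ℕ} (hB : 9 ≤ B) (hF : F < L) {a b : ℝ} (hab : a ≤ b) :
    ∃ (K : Set ℝ) (H : ℝ → ℝ), IsCompact K ∧ ContinuousOn H K ∧ MapsTo H K (Icc a b) ∧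
      K ⊆ Icc (2 / B : ℝ) (4 / B) ∧
      (∀ x ∈ K, ∀ g : ℕ, Int.fract ((B : ℝ) ^ (L * g) * x) ∈ Icc (2 / B : ℝ) (4 / B)) ∧
      dimH K < 1 ∧
      ∀ t ∈ Icc a b, {x ∈ K | H x = t}.Nonempty ∧
        dimH {x ∈ K | H x = t} = (((F : NNReal) / L : NNReal) : ℝ≥0∞) := by
  rcases hab.eq_or_lt with rfl | hab
  · obtain ⟨K, θ, hK, -, himg, hsub, hfr, hdim, hlev⟩ :=
      exists_cantor_fibered (E := 1) hB hF one_pos one_le_two fun τ => Set.to_countable _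
    refine ⟨K, fun _ => a, hK, continuousOn_const, fun x _ => ⟨le_rfl, le_rfl⟩, hsub, hfr, hdim,
      fun t ht => ?_⟩
    have hθ : ∀ x ∈ K, θ x = Real.ofDigits (b := 1) 0 := by
      intro x hx
      have : θ x ∈ range (Real.ofDigits (b := 1)) := himg ▸ mem_image_of_mem θ hx
      obtain ⟨e, he⟩ := this
      rw [← he, Subsingleton.elim e 0]
    have hmem : Real.ofDigits (b := 1) 0 ∈ θ '' K := himg ▸ mem_range_self _
    have h1 : {x ∈ K | a = t} = K := by
      ext x
      simp [le_antisymm ht.1 ht.2]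
    have h2 : {x ∈ K | θ x = Real.ofDigits (b := 1) 0} = K := by
      ext x
      simp only [mem_ofPred_eq, and_iff_left_iff_imp]
      exact hθ x
    rw [h1]
    have hd := hlev _ hmem
    rw [h2] at hd
    obtain ⟨x, hx, -⟩ := hmem
    exact ⟨⟨x, hx⟩, hd⟩
  · obtain ⟨K, θ, hK, hθ, himg, hsub, hfr, hdim, hlev⟩ :=
      exists_cantor_fibered (E := 2) hB hF two_pos le_rfl Real.countable_ofDigits_two_fiber
    have hrange : range (Real.ofDigits (b := 2)) = Icc 0 1 := by
      refine Subset.antisymm ?_ ?_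
      · rintro _ ⟨e, rfl⟩
        exact ⟨Real.ofDigits_nonneg e, Real.ofDigits_le_one e⟩
      · intro y hy
        obtain ⟨w, -, hw⟩ := Real.ofDigits_SurjOn one_lt_two hy
        exact ⟨w, hw⟩
    rw [hrange] at himg
    have hba : 0 < b - a := sub_pos.2 hab
    refine ⟨K, fun x => a + (b - a) * θ x, hK, by fun_prop, fun x hx => ?_, hsub, hfr, hdim,
      fun t ht => ?_⟩
    · have h1 : θ x ∈ Icc (0 : ℝ) 1 := himg ▸ mem_image_of_mem θ hx
      constructor <;> nlinarith [h1.1, h1.2]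
    · have hmem : (t - a) / (b - a) ∈ θ '' K := by
        rw [himg]
        exact ⟨div_nonneg (by linarith [ht.1]) hba.le, (div_le_one hba).2 (by linarith [ht.2])⟩
      have hset : {x ∈ K | a + (b - a) * θ x = t} = {x ∈ K | θ x = (t - a) / (b - a)} := by
        ext x
        simp only [mem_ofPred_eq, eq_div_iff hba.ne']
        refine and_congr_right fun _ => ⟨fun h => ?_, fun h => ?_⟩ <;> linarith
      rw [hset]
      refine ⟨?_, hlev _ hmem⟩
      obtain ⟨x, hx, hxt⟩ := hmem
      exact ⟨x, hx, hxt⟩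

lemma dimH_preimage_mul_sub {c : ℝ} (hc : c ≠ 0) (z : ℝ) (s : Set ℝ) :
    dimH ((fun x => c * (x - z)) ⁻¹' s) = dimH s := by
  set g : ℝ → ℝ := fun x => c * (x - z) with hg
  set f : ℝ → ℝ := fun y => z + c⁻¹ * y with hf
  have hgf : ∀ y, g (f y) = y := fun y => by simp only [hg, hf]; field_simp; ring
  have hfg : ∀ x, f (g x) = x := fun x => by simp only [hg, hf]; field_simp; ring
  have hgl : LipschitzWith (Real.toNNReal |c|) g := LipschitzWith.of_dist_le_mul fun x y => by
    rw [Real.dist_eq, Real.dist_eq, Real.coe_toNNReal _ (abs_nonneg _), ← abs_mul]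
    simp only [hg]
    exact le_of_eq (by ring_nf)
  have hfl : LipschitzWith (Real.toNNReal |c⁻¹|) f := LipschitzWith.of_dist_le_mul fun x y => by
    rw [Real.dist_eq, Real.dist_eq, Real.coe_toNNReal _ (abs_nonneg _), ← abs_mul]
    simp only [hf]
    exact le_of_eq (by ring_nf)
  refine le_antisymm ?_ ?_
  · have : g ⁻¹' s ⊆ f '' s := fun x hx => ⟨g x, hx, hfg x⟩
    exact (dimH_mono this).trans (hfl.dimH_image_le s)
  · have : s ⊆ g '' (g ⁻¹' s) := fun y hy => ⟨f y, by simpa [hgf] using hy, hgf y⟩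
    exact (dimH_mono this).trans (hgl.dimH_image_le _)

/-- A translated and scaled copy of the Cantor set of `exists_cantor`. -/
lemma exists_cantor_translate {B L F : ℕ} (hB : 9 ≤ B) (hF : F < L) {a b : ℝ} (hab : a ≤ b)
    {q l : ℕ} (r : ℤ) (hql : q ≤ l) :
    ∃ (K : Set ℝ) (H : ℝ → ℝ), IsClosed K ∧ ContinuousOn H K ∧ MapsTo H K (Icc a b) ∧
      K ⊆ Icc ((r : ℝ) / (B : ℝ) ^ q) (r / (B : ℝ) ^ q + 4 / B / (B : ℝ) ^ l) ∧
      (∀ x ∈ K, ∀ g : ℕ, Int.fract ((B : ℝ) ^ (l + L * g) * x) ∈ Icc (2 / B : ℝ) (4 / B)) ∧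
      dimH K < 1 ∧
      ∀ t ∈ Icc a b, {x ∈ K | H x = t}.Nonempty ∧
        dimH {x ∈ K | H x = t} = (((F : NNReal) / L : NNReal) : ℝ≥0∞) := by
  obtain ⟨K, H, hK, hH, hmap, hsub, hfr, hdim, hlev⟩ := exists_cantor hB hF hab
  have hB0 : (0 : ℝ) < B := by
    have : 0 < B := by omega
    exact_mod_cast this
  have hl : (0 : ℝ) < (B : ℝ) ^ l := by positivity
  set z : ℝ := (r : ℝ) / (B : ℝ) ^ q with hz
  set g : ℝ → ℝ := fun x => (B : ℝ) ^ l * (x - z) with hg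
  have hgc : Continuous g := by fun_prop
  refine ⟨g ⁻¹' K, H ∘ g, hK.isClosed.preimage hgc, hH.comp hgc.continuousOn fun x hx => hx,
    fun x hx => hmap hx, fun x hx => ?_, fun x hx n => ?_, ?_, fun t ht => ?_⟩
  · have h := hsub hx
    simp only [hg] at h
    have h2 : (0 : ℝ) < 2 / B := by positivity
    constructor
    · have : 0 < (B : ℝ) ^ l * (x - z) := h2.trans_le h.1
      have := (mul_pos_iff_of_pos_left hl).1 this
      linarith
    · have : x - z ≤ 4 / B / (B : ℝ) ^ l := by
        rw [le_div_iff₀ hl, mul_comm]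
        exact h.2
      linarith
  · have h_int : (B : ℝ) ^ (l + L * n) * x
        = ((r * (B : ℤ) ^ (l - q + L * n) : ℤ) : ℝ) + (B : ℝ) ^ (L * n) * g x := by
      have hpow : (B : ℝ) ^ (l + L * n) = (B : ℝ) ^ q * (B : ℝ) ^ (l - q + L * n) := by
        rw [← pow_add]
        congr 1
        omega
      have hz' : (B : ℝ) ^ (l + L * n) * z = r * (B : ℝ) ^ (l - q + L * n) := by
        rw [hpow, hz]
        field_simp
      push_cast
      rw [← hz', pow_add]
      simp only [hg]
      ring
    rw [h_int, Int.fract_intCast_add]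
    exact hfr _ hx n
  · rw [dimH_preimage_mul_sub hl.ne']
    exact hdim
  · have hset : {x ∈ g ⁻¹' K | (H ∘ g) x = t} = g ⁻¹' {y ∈ K | H y = t} := rfl
    obtain ⟨⟨y, hy⟩, h2⟩ := hlev t ht
    rw [hset, dimH_preimage_mul_sub hl.ne']
    refine ⟨⟨z + y / (B : ℝ) ^ l, ?_⟩, h2⟩
    have : g (z + y / (B : ℝ) ^ l) = y := by
      simp only [hg]
      field_simp
      ring
    rw [mem_preimage, this]
    exact hy

lemma holderExp_bumpSeries_le {B N : ℕ} (hN : 1 ≤ N) (hB : 2 * N + 2 ≤ B)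
    {c : ℕ → ℤ → ℝ} (hc : ∀ k m, ¬ (B : ℤ) ∣ m → c k m = 0) {a h x : ℝ} (ha : 0 < a) (hh : 0 ≤ h)
    (hhN : h < 2 * N + 1)
    (hbig : ∀ h' > h, ∃ᶠ k : ℕ in atTop, ∃ m : ℤ, (B : ℤ) ∣ m ∧ |(B : ℝ) ^ k * x - m| ≤ B ∧
      a * (B : ℝ) ^ (-((k : ℝ) * h')) ≤ |c k m|) :
    holderExp (bumpSeries B N c) x ≤ h := by
  refine holderExp_le fun γ hγ0 hγ => ?_
  by_contra! hlt
  have hB1 : (1 : ℝ) < B := by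
    have : 1 < B := by omega
    exact_mod_cast this
  have hB0 : (0 : ℝ) < B := by linarith
  set γ' := min γ (2 * N + 1) with hγ'
  have hhγ' : h < γ' := lt_min hlt hhN
  have hγ'0 : 0 ≤ γ' := hh.trans hhγ'.le
  obtain ⟨h', hh', h'γ⟩ := exists_between hhγ'
  obtain ⟨C, k₀, hC⟩ := exists_abs_coeff_le_of_holderAt hN hB hc hγ'0 (min_le_right _ _)
    (hγ.mono hγ'0 (min_le_left _ _))
  have hlim : Tendsto (fun k : ℕ => (B : ℝ) ^ ((k : ℝ) * (γ' - h'))) atTop atTop := by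
    have h1 : (1 : ℝ) < (B : ℝ) ^ (γ' - h') := Real.one_lt_rpow hB1 (by linarith)
    refine (tendsto_pow_atTop_atTop_of_one_lt h1).congr fun k => ?_
    rw [← Real.rpow_natCast, ← Real.rpow_mul hB0.le, mul_comm]
  have hev := (hlim.eventually_gt_atTop (C / a)).and (eventually_ge_atTop k₀)
  obtain ⟨k, ⟨m, hm, hxm, hle⟩, hgt, hk⟩ := ((hbig h' hh').and_eventually hev).exists
  have h1 := hle.trans (hC k hk m hm hxm)
  rw [div_lt_iff₀ ha] at hgt
  have h2 : (B : ℝ) ^ (-((k : ℝ) * h'))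
      = (B : ℝ) ^ ((k : ℝ) * (γ' - h')) * (B : ℝ) ^ (-((k : ℝ) * γ')) := by
    rw [← Real.rpow_add hB0]
    congr 1
    ring
  rw [h2, ← mul_assoc, mul_comm a] at h1
  exact absurd (le_of_mul_le_mul_right h1 (by positivity)) (not_le.2 hgt)

/-! ### Marked Cantor sets -/

/-- Coefficients marking the `B`-adic intervals of generation `j + 1`, `j ∈ S`, next to the points of
`K`: the coefficient next to `x` is `B ^ (-(j + 1) H x)`. -/
noncomputable def zoneCoeff (B : ℕ) (K : Set ℝ) (S : Set ℕ) (H : ℝ → ℝ) (k : ℕ) (m : ℤ) : ℝ :=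
  if h : ∃ x ∈ K, ∃ j ∈ S, k = j + 1 ∧ m = B * ⌊(B : ℝ) ^ j * x⌋ then
    (B : ℝ) ^ (-((k : ℝ) * H h.choose)) else 0

section zoneCoeff

variable {B : ℕ} {K : Set ℝ} {S : Set ℕ} {H : ℝ → ℝ}

lemma zoneCoeff_nonneg (k : ℕ) (m : ℤ) : 0 ≤ zoneCoeff B K S H k m := by
  unfold zoneCoeff
  split_ifs <;> positivity

lemma exists_of_zoneCoeff_ne_zero {k : ℕ} {m : ℤ} (h : zoneCoeff B K S H k m ≠ 0) :
    ∃ x ∈ K, ∃ j ∈ S, k = j + 1 ∧ m = B * ⌊(B : ℝ) ^ j * x⌋ ∧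
      zoneCoeff B K S H k m = (B : ℝ) ^ (-((k : ℝ) * H x)) := by
  unfold zoneCoeff at h ⊢
  split_ifs at h ⊢ with hex
  · obtain ⟨hx, j, hj, hk, hm⟩ := hex.choose_spec
    exact ⟨_, hx, j, hj, hk, hm, rfl⟩
  · exact absurd rfl h

lemma exists_zoneCoeff_eq (hB : 0 < B) {x : ℝ} (hx : x ∈ K) {j : ℕ} (hj : j ∈ S) :
    ∃ x' ∈ K, ⌊(B : ℝ) ^ j * x'⌋ = ⌊(B : ℝ) ^ j * x⌋ ∧
      zoneCoeff B K S H (j + 1) (B * ⌊(B : ℝ) ^ j * x⌋)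
        = (B : ℝ) ^ (-(((j + 1 : ℕ) : ℝ) * H x')) := by
  have hne : zoneCoeff B K S H (j + 1) (B * ⌊(B : ℝ) ^ j * x⌋) ≠ 0 := by
    unfold zoneCoeff
    rw [dif_pos ⟨x, hx, j, hj, rfl, rfl⟩]
    positivity
  obtain ⟨x', hx', j', -, hj', hm, heq⟩ := exists_of_zoneCoeff_ne_zero hne
  obtain rfl : j = j' := by omega
  refine ⟨x', hx', ?_, heq⟩
  exact (mul_left_cancel₀ (by exact_mod_cast hB.ne') hm).symm

lemma zoneCoeff_le {hmin : ℝ} (hB : 2 ≤ B) (hH : ∀ x ∈ K, hmin ≤ H x) (k : ℕ) (m : ℤ) :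
    zoneCoeff B K S H k m ≤ (B : ℝ) ^ (-((k : ℝ) * hmin)) := by
  by_cases h : zoneCoeff B K S H k m = 0
  · rw [h]
    positivity
  · obtain ⟨x, hx, -, -, -, -, heq⟩ := exists_of_zoneCoeff_ne_zero h
    rw [heq]
    have hB1 : (1 : ℝ) ≤ B := by exact_mod_cast (by omega : 1 ≤ B)
    refine Real.rpow_le_rpow_of_exponent_le hB1 (neg_le_neg ?_)
    exact mul_le_mul_of_nonneg_left (hH x hx) (by positivity)

lemma dvd_of_zoneCoeff_ne_zero {k : ℕ} {m : ℤ} (h : zoneCoeff B K S H k m ≠ 0) : (B : ℤ) ∣ m := by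
  obtain ⟨x, -, j, -, -, hm, -⟩ := exists_of_zoneCoeff_ne_zero h
  exact ⟨_, hm⟩

/-- If the interval of generation `k` containing `y` is marked, then `y` is at distance at least
`B ^ (-k)` from `K`, but at distance of order `B ^ (-k)` from a marking point. -/
lemma exists_near_of_zoneCoeff_ne_zero (hB : 9 ≤ B)
    (hS : ∀ x ∈ K, ∀ j ∈ S, Int.fract ((B : ℝ) ^ j * x) ∈ Icc (2 / B : ℝ) (4 / B)) {k : ℕ} {y : ℝ}
    (h : zoneCoeff B K S H k ⌊(B : ℝ) ^ k * y⌋ ≠ 0) :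
    (∃ x' ∈ K, |x' - y| ≤ 4 * ((B : ℝ) ^ k)⁻¹ ∧
      zoneCoeff B K S H k ⌊(B : ℝ) ^ k * y⌋ = (B : ℝ) ^ (-((k : ℝ) * H x'))) ∧
    (∃ j ∈ S, k = j + 1) ∧
    ∀ x ∈ K, ((B : ℝ) ^ k)⁻¹ ≤ |y - x| := by
  obtain ⟨x', hx', j, hj, rfl, hm, heq⟩ := exists_of_zoneCoeff_ne_zero h
  have hB9 : (9 : ℝ) ≤ B := by exact_mod_cast hB
  have hB0 : (0 : ℝ) < B := by linarith
  set p := ⌊(B : ℝ) ^ j * x'⌋ with hp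
  have hy := Int.floor_eq_iff.1 hm
  push_cast at hy
  have hpow : (B : ℝ) ^ (j + 1) = B * (B : ℝ) ^ j := pow_succ' _ _
  have hj0 : (0 : ℝ) < (B : ℝ) ^ j := by positivity
  rw [hpow, mul_assoc] at hy
  have hfr : ∀ x ∈ K, (2 : ℝ) ≤ B * ((B : ℝ) ^ j * x - ⌊(B : ℝ) ^ j * x⌋) ∧
      B * ((B : ℝ) ^ j * x - ⌊(B : ℝ) ^ j * x⌋) ≤ 4 := by
    intro x hx
    have h1 := hS x hx j hj
    rw [Int.self_sub_floor]
    constructor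
    · have := (div_le_iff₀ hB0).1 h1.1
      linarith
    · have := (le_div_iff₀ hB0).1 h1.2
      linarith
  have habs : ∀ x, |y - x| = |(B : ℝ) ^ (j + 1) * y - (B : ℝ) ^ (j + 1) * x|
      * ((B : ℝ) ^ (j + 1))⁻¹ := by
    intro x
    rw [← mul_sub, abs_mul, abs_of_pos (by positivity : (0 : ℝ) < (B : ℝ) ^ (j + 1))]
    field_simp
  refine ⟨⟨x', hx', ?_, heq⟩, ⟨j, hj, rfl⟩, fun x hx => ?_⟩
  · rw [abs_sub_comm, habs]
    gcongr
    have h1 := hfr x' hx'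
    rw [← hp] at h1
    rw [hpow, mul_assoc, mul_assoc, abs_le]
    constructor <;> nlinarith
  · rw [habs]
    have h1 := hfr x hx
    set n := ⌊(B : ℝ) ^ j * x⌋ with hn
    refine le_mul_of_one_le_left (by positivity) ?_
    rw [hpow, mul_assoc, mul_assoc, le_abs]
    rcases le_or_gt p n with hpn | hpn
    · right
      have : (p : ℝ) ≤ n := by exact_mod_cast hpn
      nlinarith
    · left
      have : (n : ℝ) + 1 ≤ p := by exact_mod_cast hpn
      nlinarith

lemma rpow_neg_natCast_mul (hB : 2 ≤ B) (k : ℕ) (s : ℝ) :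
    (B : ℝ) ^ (-((k : ℝ) * s)) = (((B : ℝ) ^ k)⁻¹) ^ s := by
  have hB0 : (0 : ℝ) < B := by exact_mod_cast (by omega : 0 < B)
  rw [← Real.rpow_natCast, ← Real.rpow_neg hB0.le, ← Real.rpow_mul hB0.le, neg_mul]

lemma holderAt_bumpSeries_zoneCoeff_of_mem {N : ℕ} (hB : 9 ≤ B) (hH : ContinuousOn H K)
    (hS : ∀ x ∈ K, ∀ j ∈ S, Int.fract ((B : ℝ) ^ j * x) ∈ Icc (2 / B : ℝ) (4 / B))
    {w γ x : ℝ} (hw : 0 ≤ w) (hx : x ∈ K) (hγ0 : 0 ≤ γ) (hγ : γ < H x) :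
    HolderAt (bumpSeries B N fun k m => w * zoneCoeff B K S H k m) γ x := by
  have hB1 : (1 : ℝ) ≤ B := by exact_mod_cast (by omega : 1 ≤ B)
  have hB0 : (0 : ℝ) < B := by linarith
  obtain ⟨γ', hγγ', hγ'⟩ := exists_between hγ
  obtain ⟨ε, hε, hεK⟩ := Metric.mem_nhdsWithin_iff.1 ((hH x hx).eventually (lt_mem_nhds hγ'))
  refine holderAt_bumpSeries_of_local (by omega) (C := w) (δ := ε / 5) (σ := γ' - γ) (by positivity)
    (by linarith) fun y hy k => ?_
  by_cases hne : zoneCoeff B K S H k ⌊(B : ℝ) ^ k * y⌋ = 0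
  · rw [hne, mul_zero, abs_zero]
    positivity
  obtain ⟨⟨x', hx', hx'y, heq⟩, -, hfar⟩ := exists_near_of_zoneCoeff_ne_zero hB hS hne
  have hyx := hfar x hx
  have hx'x : |x' - x| < ε := by
    calc |x' - x| = |(x' - y) + (y - x)| := by ring_nf
      _ ≤ |x' - y| + |y - x| := abs_add_le _ _
      _ < ε := by linarith
  have hHx' : γ' < H x' := hεK ⟨by rwa [Metric.mem_ball, Real.dist_eq], hx'⟩
  rw [abs_mul, abs_of_nonneg hw, abs_of_nonneg (zoneCoeff_nonneg k _), heq, mul_assoc]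
  gcongr
  calc (B : ℝ) ^ (-((k : ℝ) * H x')) ≤ (B : ℝ) ^ (-((k : ℝ) * γ')) := by
        refine Real.rpow_le_rpow_of_exponent_le hB1 (neg_le_neg ?_)
        exact mul_le_mul_of_nonneg_left hHx'.le (by positivity)
    _ = (B : ℝ) ^ (-((k : ℝ) * γ)) * (B : ℝ) ^ (-((k : ℝ) * (γ' - γ))) := by
        rw [← Real.rpow_add hB0]
        congr 1
        ring
    _ ≤ _ := by
        gcongr
        rw [rpow_neg_natCast_mul (by omega)]
        exact Real.rpow_le_rpow (by positivity) hyx hγ0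

lemma holderAt_bumpSeries_zoneCoeff_of_notMem {N : ℕ} (hB : 9 ≤ B) (hK : IsClosed K)
    (hH : ∀ x ∈ K, 0 ≤ H x)
    (hS : ∀ x ∈ K, ∀ j ∈ S, Int.fract ((B : ℝ) ^ j * x) ∈ Icc (2 / B : ℝ) (4 / B))
    {w γ x : ℝ} (hw : 0 ≤ w) (hx : x ∉ K) (hγ0 : 0 < γ) (hγN : γ ≤ N) :
    HolderAt (bumpSeries B N fun k m => w * zoneCoeff B K S H k m) γ x := by
  have hB1 : (1 : ℝ) < B := by exact_mod_cast (by omega : 1 < B)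
  have hB0 : (0 : ℝ) < B := by linarith
  obtain ⟨ε, hε, hεK⟩ := Metric.isOpen_iff.1 hK.isOpen_compl x hx
  obtain ⟨k₁, hk₁⟩ := exists_pow_lt_of_lt_one (by positivity : 0 < ε / 8) (inv_lt_one_of_one_lt₀ hB1)
  have hle1 : ∀ k m, zoneCoeff B K S H k m ≤ 1 := fun k m => by
    simpa using zoneCoeff_le (S := S) (by omega : 2 ≤ B) hH k m
  set c : ℕ → ℤ → ℝ := fun k m => w * zoneCoeff B K S H k m with hcdef
  have hdom : ∀ k m, |if k < k₁ then c k m else 0|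
      ≤ w * (B : ℝ) ^ ((k₁ : ℝ) * (γ + 1)) * (B : ℝ) ^ (-((k : ℝ) * (γ + 1))) := by
    intro k m
    split_ifs with hk
    · rw [abs_of_nonneg (mul_nonneg hw (zoneCoeff_nonneg k m)), mul_assoc, ← Real.rpow_add hB0]
      refine mul_le_mul_of_nonneg_left ((hle1 k m).trans (Real.one_le_rpow hB1.le ?_)) hw
      have : (k : ℝ) ≤ k₁ := by exact_mod_cast hk.le
      nlinarith
    · rw [abs_zero]
      positivity
  have h1 := holderAt_bumpSeries_of_uniform (N := N) (by omega) hγ0 (by linarith) hγN hdom x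
  have hzero : ∀ y, |y - x| < ε / 2 → ∀ k, k₁ ≤ k → c k ⌊(B : ℝ) ^ k * y⌋ = 0 := by
    intro y hy k hk
    by_contra hne
    obtain ⟨⟨x', hx', hx'y, -⟩, -, -⟩ :=
      exists_near_of_zoneCoeff_ne_zero hB hS (right_ne_zero_of_mul hne)
    refine hεK ?_ hx'
    rw [Metric.mem_ball, Real.dist_eq]
    have h2 : ((B : ℝ) ^ k)⁻¹ ≤ ((B : ℝ)⁻¹) ^ k₁ := by
      rw [← inv_pow]
      exact pow_le_pow_of_le_one (by positivity) (inv_le_one_of_one_le₀ hB1.le) hk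
    calc |x' - x| = |(x' - y) + (y - x)| := by ring_nf
      _ ≤ |x' - y| + |y - x| := abs_add_le _ _
      _ < ε := by linarith
  obtain ⟨P, C, δ, hC, hδ, hP, hbd⟩ := h1
  refine ⟨P, C, min δ (ε / 2), hC, by positivity, hP, fun y hy => ?_⟩
  have hval : bumpSeries B N c y = bumpSeries B N (fun k m => if k < k₁ then c k m else 0) y := by
    refine tsum_congr fun k => ?_
    by_cases hk : k < k₁
    · simp [hk]
    · simp [hk, hzero y (hy.trans_le (min_le_right _ _)) k (not_lt.1 hk)]
  rw [hval]
  exact hbd y (hy.trans_le (min_le_left _ _))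

lemma eventually_le_zoneCoeff (hB : 9 ≤ B) (hH : ContinuousOn H K) {x h : ℝ} (hx : x ∈ K)
    (hh : H x < h) :
    ∀ᶠ j : ℕ in atTop, j ∈ S → (B : ℝ) ^ (-(((j + 1 : ℕ) : ℝ) * h))
      ≤ zoneCoeff B K S H (j + 1) (B * ⌊(B : ℝ) ^ j * x⌋) := by
  have hB1 : (1 : ℝ) < B := by exact_mod_cast (by omega : 1 < B)
  have hB0 : (0 : ℝ) < B := by linarith
  obtain ⟨ε, hε, hεK⟩ := Metric.mem_nhdsWithin_iff.1 ((hH x hx).eventually (gt_mem_nhds hh))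
  have hlim := tendsto_pow_atTop_nhds_zero_of_lt_one (by positivity : (0 : ℝ) ≤ (B : ℝ)⁻¹)
    (inv_lt_one_of_one_lt₀ hB1)
  filter_upwards [hlim.eventually (gt_mem_nhds hε)] with j hj hjS
  obtain ⟨x', hx', hfl, heq⟩ := exists_zoneCoeff_eq (B := B) (H := H) (by omega) hx hjS
  rw [heq]
  refine Real.rpow_le_rpow_of_exponent_le hB1.le (neg_le_neg ?_)
  refine mul_le_mul_of_nonneg_left (le_of_lt (hεK ⟨?_, hx'⟩)) (by positivity)
  rw [Metric.mem_ball, Real.dist_eq]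
  refine lt_of_le_of_lt ?_ hj
  have h1 := Int.abs_sub_lt_one_of_floor_eq_floor hfl
  rw [← mul_sub, abs_mul, abs_of_pos (by positivity : (0 : ℝ) < (B : ℝ) ^ j)] at h1
  rw [inv_pow, ← one_div, le_div_iff₀ (by positivity), mul_comm]
  exact h1.le

end zoneCoeff

/-! ### Families of marked sets -/

/-- A sequence of closed sets `K i`, located near the points `z i`, marked at the generations
`j ∈ S i` by the exponents `H i`. The sets are small compared to the radii `ρ i`, and the balls of
radius `ρ i` around `z i` avoid the sets of smaller index. -/
structure ZoneFamily (B : ℕ) (hmin β : ℝ) where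
  K : ℕ → Set ℝ
  S : ℕ → Set ℕ
  H : ℕ → ℝ → ℝ
  z : ℕ → ℝ
  ρ : ℕ → ℝ
  l : ℕ → ℕ
  isClosed_K : ∀ i, IsClosed (K i)
  continuousOn_H : ∀ i, ContinuousOn (H i) (K i)
  H_mem : ∀ i, ∀ x ∈ K i, H i x ∈ Icc hmin β
  infinite_S : ∀ i, (S i).Infinite
  l_le : ∀ i, ∀ j ∈ S i, l i ≤ j
  fract_mem : ∀ i, ∀ x ∈ K i, ∀ j ∈ S i, Int.fract ((B : ℝ) ^ j * x) ∈ Icc (2 / B : ℝ) (4 / B)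
  abs_sub_le : ∀ i, ∀ x ∈ K i, |x - z i| ≤ ρ i / 4
  inv_pow_le : ∀ i, 4 * ((B : ℝ) ^ (l i))⁻¹ ≤ ρ i / 4
  rpow_le : ∀ i, (B : ℝ) ^ (-((l i : ℝ) * (hmin / 2))) ≤ (ρ i / 2) ^ β
  notMem_ball : ∀ i j, j < i → ∀ x ∈ K j, x ∉ ball (z i) (ρ i)

namespace ZoneFamily

variable {B : ℕ} {hmin β : ℝ} (M : ZoneFamily B hmin β)

/-- The coefficients marking the `i`-th set. -/
noncomputable def zone (i k : ℕ) (m : ℤ) : ℝ := zoneCoeff B (M.K i) (M.S i) (M.H i) k m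

/-- The coefficients marking all the sets, added to a uniform background of exponent `β`. -/
noncomputable def coeff (A : ℝ) (k : ℕ) (m : ℤ) : ℝ :=
  (if (B : ℤ) ∣ m then A * (B : ℝ) ^ (-((k : ℝ) * β)) else 0) + ∑' i, A / 2 / 2 ^ i * M.zone i k m

lemma zone_nonneg (i k : ℕ) (m : ℤ) : 0 ≤ M.zone i k m := zoneCoeff_nonneg k m

lemma zone_le (hB : 9 ≤ B) (i k : ℕ) (m : ℤ) : M.zone i k m ≤ (B : ℝ) ^ (-((k : ℝ) * hmin)) :=
  zoneCoeff_le (by omega) (fun x hx => (M.H_mem i x hx).1) k m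

lemma zone_eq_zero {i k : ℕ} {m : ℤ} (hm : ¬ (B : ℤ) ∣ m) : M.zone i k m = 0 := by
  by_contra h
  exact hm (dvd_of_zoneCoeff_ne_zero h)

lemma summable_zone (hB : 9 ≤ B) {A : ℝ} (hA : 0 ≤ A) (k : ℕ) (m : ℤ) :
    Summable fun i => A / 2 / 2 ^ i * M.zone i k m :=
  Summable.of_nonneg_of_le (fun i => mul_nonneg (by positivity) (M.zone_nonneg i k m))
    (fun i => mul_le_mul_of_nonneg_left (M.zone_le hB i k m) (by positivity))
    ((hasSum_geometric_two' A).summable.mul_right _)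

lemma tsum_zone_nonneg {A : ℝ} (hA : 0 ≤ A) (k : ℕ) (m : ℤ) :
    0 ≤ ∑' i, A / 2 / 2 ^ i * M.zone i k m :=
  tsum_nonneg fun i => mul_nonneg (by positivity) (M.zone_nonneg i k m)

lemma tsum_zone_le (hB : 9 ≤ B) {A : ℝ} (hA : 0 ≤ A) (k : ℕ) (m : ℤ) :
    ∑' i, A / 2 / 2 ^ i * M.zone i k m ≤ A * (B : ℝ) ^ (-((k : ℝ) * hmin)) := by
  refine (M.summable_zone hB hA k m).tsum_le_of_sum_le fun s => ?_
  refine le_trans ?_ (sum_le_hasSum s (fun i _ => by positivity)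
    ((hasSum_geometric_two' A).mul_right ((B : ℝ) ^ (-((k : ℝ) * hmin)))))
  exact Finset.sum_le_sum fun i _ =>
    mul_le_mul_of_nonneg_left (M.zone_le hB i k m) (by positivity)

lemma coeff_nonneg {A : ℝ} (hA : 0 ≤ A) (k : ℕ) (m : ℤ) : 0 ≤ M.coeff A k m := by
  refine add_nonneg ?_ (M.tsum_zone_nonneg hA k m)
  split_ifs <;> positivity

lemma base_le (hB : 9 ≤ B) (hβ : hmin ≤ β) {A : ℝ} (hA : 0 ≤ A) (k : ℕ) (m : ℤ) :
    |if (B : ℤ) ∣ m then A * (B : ℝ) ^ (-((k : ℝ) * β)) else 0|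
      ≤ A * (B : ℝ) ^ (-((k : ℝ) * hmin)) := by
  have hB1 : (1 : ℝ) ≤ B := by exact_mod_cast (by omega : 1 ≤ B)
  split_ifs
  · rw [abs_of_nonneg (by positivity)]
    gcongr
  · rw [abs_zero]
    positivity

lemma coeff_le (hB : 9 ≤ B) (hβ : hmin ≤ β) {A : ℝ} (hA : 0 ≤ A) (k : ℕ) (m : ℤ) :
    M.coeff A k m ≤ 2 * A * (B : ℝ) ^ (-((k : ℝ) * hmin)) := by
  have h1 := (le_abs_self _).trans (base_le hB hβ hA k m)
  have h2 := M.tsum_zone_le hB hA k m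
  unfold coeff
  linarith

lemma abs_coeff_le (hB : 9 ≤ B) (hβ : hmin ≤ β) {A : ℝ} (hA : 0 ≤ A) (k : ℕ) (m : ℤ) :
    |M.coeff A k m| ≤ 2 * A * (B : ℝ) ^ (-((k : ℝ) * hmin)) := by
  rw [abs_of_nonneg (M.coeff_nonneg hA k m)]
  exact M.coeff_le hB hβ hA k m

lemma coeff_eq_zero {A : ℝ} (k : ℕ) (m : ℤ) (hm : ¬ (B : ℤ) ∣ m) : M.coeff A k m = 0 := by
  simp [coeff, hm, M.zone_eq_zero hm]

/-- Away from the `i`-th ball, the contribution of the `i`-th set is uniformly small. -/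
lemma zone_le_of_notMem_ball (hB : 9 ≤ B) (hmin0 : 0 < hmin) (hβ : hmin ≤ β) {i : ℕ} {x : ℝ}
    (hx : x ∉ ball (M.z i) (M.ρ i)) (k : ℕ) (y : ℝ) :
    M.zone i k ⌊(B : ℝ) ^ k * y⌋ ≤ (B : ℝ) ^ (-((k : ℝ) * (hmin / 2))) * |y - x| ^ β := by
  have hB1 : (1 : ℝ) ≤ B := by exact_mod_cast (by omega : 1 ≤ B)
  have hB0 : (0 : ℝ) < B := by linarith
  by_cases hne : M.zone i k ⌊(B : ℝ) ^ k * y⌋ = 0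
  · rw [hne]
    positivity
  obtain ⟨⟨x', hx', hx'y, -⟩, ⟨j, hj, hk⟩, -⟩ :=
    exists_near_of_zoneCoeff_ne_zero hB (M.fract_mem i) hne
  have hlk : M.l i ≤ k := (M.l_le i j hj).trans (by omega)
  have hρ : 0 ≤ M.ρ i := by
    have h1 := M.inv_pow_le i
    have h2 : 0 ≤ ((B : ℝ) ^ (M.l i))⁻¹ := by positivity
    linarith
  have hfar : M.ρ i / 2 ≤ |y - x| := by
    rw [Metric.mem_ball, Real.dist_eq, not_lt] at hx
    have h1 := M.inv_pow_le i
    have h2 : ((B : ℝ) ^ k)⁻¹ ≤ ((B : ℝ) ^ (M.l i))⁻¹ :=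
      inv_anti₀ (by positivity) (pow_le_pow_right₀ hB1 hlk)
    have h3 := M.abs_sub_le i x' hx'
    have h4 : |x - M.z i| ≤ |y - x| + |x' - y| + |x' - M.z i| := by
      rw [abs_sub_comm y x, abs_sub_comm x' y]
      calc |x - M.z i| = |(x - y) + (y - x') + (x' - M.z i)| := by ring_nf
        _ ≤ _ := abs_add_three _ _ _
    linarith
  calc M.zone i k ⌊(B : ℝ) ^ k * y⌋ ≤ (B : ℝ) ^ (-((k : ℝ) * hmin)) := M.zone_le hB i k _
    _ = (B : ℝ) ^ (-((k : ℝ) * (hmin / 2))) * (B : ℝ) ^ (-((k : ℝ) * (hmin / 2))) := by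
        rw [← Real.rpow_add hB0]
        congr 1
        ring
    _ ≤ (B : ℝ) ^ (-((k : ℝ) * (hmin / 2))) * |y - x| ^ β := by
        gcongr
        calc (B : ℝ) ^ (-((k : ℝ) * (hmin / 2))) ≤ (B : ℝ) ^ (-((M.l i : ℝ) * (hmin / 2))) := by
              gcongr
          _ ≤ (M.ρ i / 2) ^ β := M.rpow_le i
          _ ≤ |y - x| ^ β := Real.rpow_le_rpow (by positivity) hfar (by linarith)

lemma holderAt_finset_sum {N : ℕ} (hB : 9 ≤ B) (hmin0 : 0 < hmin) {A γ x : ℝ} (hA : 0 ≤ A)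
    (hγ0 : 0 < γ) (hγN : γ ≤ N) (hK : ∀ i, x ∈ M.K i → γ < M.H i x) (n : ℕ) :
    HolderAt (bumpSeries B N fun k m => ∑ i ∈ Finset.range n, A / 2 / 2 ^ i * M.zone i k m) γ x := by
  induction n with
  | zero =>
    refine holderAt_bumpSeries_of_local (by omega) (C := 0) one_pos one_pos fun y _ k => ?_
    simp
  | succ n ih =>
    have hw : ∀ i : ℕ, 0 ≤ A / 2 / 2 ^ i := fun i => by positivity
    have hz : ∀ i k m, |A / 2 / 2 ^ i * M.zone i k m|
        ≤ A / 2 / 2 ^ i * (B : ℝ) ^ (-((k : ℝ) * hmin)) := fun i k m => by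
      rw [abs_of_nonneg (mul_nonneg (hw i) (M.zone_nonneg i k m))]
      exact mul_le_mul_of_nonneg_left (M.zone_le hB i k m) (hw i)
    have hs : ∀ k m, |∑ i ∈ Finset.range n, A / 2 / 2 ^ i * M.zone i k m|
        ≤ (∑ i ∈ Finset.range n, A / 2 / 2 ^ i) * (B : ℝ) ^ (-((k : ℝ) * hmin)) := fun k m => by
      rw [Finset.sum_mul]
      exact (Finset.abs_sum_le_sum_abs _ _).trans (Finset.sum_le_sum fun i _ => hz i k m)
    simp only [Finset.sum_range_succ]
    rw [bumpSeries_add (by omega) hmin0 hs (hz n)]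
    refine ih.add ?_
    by_cases hx : x ∈ M.K n
    · exact holderAt_bumpSeries_zoneCoeff_of_mem hB (M.continuousOn_H n) (M.fract_mem n) (hw n) hx
        hγ0.le (hK n hx)
    · exact holderAt_bumpSeries_zoneCoeff_of_notMem hB (M.isClosed_K n)
        (fun x hx => hmin0.le.trans (M.H_mem n x hx).1) (M.fract_mem n) (hw n) hx hγ0 hγN

lemma holderAt_bumpSeries_coeff {N : ℕ} (hB : 9 ≤ B) (hmin0 : 0 < hmin) (hβ : hmin ≤ β) {A γ x : ℝ}
    (hA : 0 ≤ A) (hγ0 : 0 < γ) (hγN : γ ≤ N) (hγβ : γ < β) (hK : ∀ i, x ∈ M.K i → γ < M.H i x)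
    (hx : ∀ᶠ i in atTop, x ∉ ball (M.z i) (M.ρ i)) :
    HolderAt (bumpSeries B N (M.coeff A)) γ x := by
  obtain ⟨n, hn⟩ := eventually_atTop.1 hx
  have hw : ∀ i : ℕ, 0 ≤ A / 2 / 2 ^ i := fun i => by positivity
  have hs : ∀ k m, |∑ i ∈ Finset.range n, A / 2 / 2 ^ i * M.zone i k m|
      ≤ A * (B : ℝ) ^ (-((k : ℝ) * hmin)) := fun k m => by
    rw [abs_of_nonneg (Finset.sum_nonneg fun i _ => mul_nonneg (hw i) (M.zone_nonneg i k m))]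
    exact ((M.summable_zone hB hA k m).sum_le_tsum _
      fun i _ => mul_nonneg (hw i) (M.zone_nonneg i k m)).trans (M.tsum_zone_le hB hA k m)
  have htsum : ∀ k m, 0 ≤ ∑' i, A / 2 / 2 ^ (i + n) * M.zone (i + n) k m := fun k m =>
    tsum_nonneg fun i => mul_nonneg (hw _) (M.zone_nonneg _ k m)
  have hsplit : ∀ k m, ∑ i ∈ Finset.range n, A / 2 / 2 ^ i * M.zone i k m
      + ∑' i, A / 2 / 2 ^ (i + n) * M.zone (i + n) k m = ∑' i, A / 2 / 2 ^ i * M.zone i k m :=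
    fun k m => (M.summable_zone hB hA k m).sum_add_tsum_nat_add n
  have ht : ∀ k m, |∑' i, A / 2 / 2 ^ (i + n) * M.zone (i + n) k m|
      ≤ A * (B : ℝ) ^ (-((k : ℝ) * hmin)) := fun k m => by
    rw [abs_of_nonneg (htsum k m)]
    refine le_trans ?_ (M.tsum_zone_le hB hA k m)
    rw [← hsplit k m]
    exact le_add_of_nonneg_left
      (Finset.sum_nonneg fun i _ => mul_nonneg (hw i) (M.zone_nonneg i k m))
  have hst : ∀ k m, |∑' i, A / 2 / 2 ^ i * M.zone i k m|
      ≤ A * (B : ℝ) ^ (-((k : ℝ) * hmin)) := fun k m => by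
    rw [abs_of_nonneg (M.tsum_zone_nonneg hA k m)]
    exact M.tsum_zone_le hB hA k m
  have hbase : HolderAt (bumpSeries B N fun k m =>
      if (B : ℤ) ∣ m then A * (B : ℝ) ^ (-((k : ℝ) * β)) else 0) γ x :=
    holderAt_bumpSeries_of_uniform (by omega) hγ0 hγβ hγN
      (fun k m => base_le hB le_rfl hA k m) x
  have htail : HolderAt (bumpSeries B N fun k m =>
      ∑' i, A / 2 / 2 ^ (i + n) * M.zone (i + n) k m) γ x := by
    refine holderAt_bumpSeries_of_local (by omega) (C := A) (σ := hmin / 2) one_pos (by positivity)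
      fun y hy k => ?_
    rw [abs_of_nonneg (htsum k _)]
    have hsum := hasSum_geometric_two' A
    have hle : ∑' i, A / 2 / 2 ^ (i + n) ≤ A := by
      have h1 := hsum.summable.sum_add_tsum_nat_add n
      rw [hsum.tsum_eq] at h1
      have h2 : 0 ≤ ∑ i ∈ Finset.range n, A / 2 / 2 ^ i := Finset.sum_nonneg fun i _ => hw i
      linarith
    have hsum' : Summable fun i => A / 2 / 2 ^ (i + n) := (summable_nat_add_iff n).2 hsum.summable
    have hbd : ∀ i, A / 2 / 2 ^ (i + n) * M.zone (i + n) k ⌊(B : ℝ) ^ k * y⌋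
        ≤ A / 2 / 2 ^ (i + n) * ((B : ℝ) ^ (-((k : ℝ) * (hmin / 2))) * |y - x| ^ γ) := fun i => by
      refine mul_le_mul_of_nonneg_left ?_ (hw _)
      refine (M.zone_le_of_notMem_ball hB hmin0 hβ (hn (i + n) (by omega)) k y).trans ?_
      refine mul_le_mul_of_nonneg_left ?_ (by positivity)
      exact Real.rpow_le_rpow_of_exponent_ge_of_imp (abs_nonneg _) hy.le hγβ.le
        fun _ h => absurd h (hγ0.trans hγβ).ne'
    calc _ ≤ ∑' i, A / 2 / 2 ^ (i + n) * ((B : ℝ) ^ (-((k : ℝ) * (hmin / 2))) * |y - x| ^ γ) :=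
          ((summable_nat_add_iff n).2 (M.summable_zone hB hA k _)).tsum_le_tsum hbd
            (hsum'.mul_right _)
      _ = (∑' i, A / 2 / 2 ^ (i + n)) * ((B : ℝ) ^ (-((k : ℝ) * (hmin / 2))) * |y - x| ^ γ) :=
          tsum_mul_right
      _ ≤ A * ((B : ℝ) ^ (-((k : ℝ) * (hmin / 2))) * |y - x| ^ γ) := by gcongr
      _ = _ := by ring
  have hrest := (M.holderAt_finset_sum hB hmin0 hA hγ0 hγN hK n).add htail
  rw [← bumpSeries_add (by omega) hmin0 hs ht] at hrest
  simp only [hsplit] at hrest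
  have hall := hbase.add hrest
  rwa [← bumpSeries_add (by omega) hmin0 (base_le hB hβ hA) hst] at hall

lemma holderAt_of_lt_hmin {N : ℕ} (hB : 9 ≤ B) (hβ : hmin ≤ β) {A γ : ℝ} (hA : 0 ≤ A) (hγ0 : 0 < γ)
    (hγN : γ ≤ N) (hγ : γ < hmin) (x : ℝ) : HolderAt (bumpSeries B N (M.coeff A)) γ x :=
  holderAt_bumpSeries_of_uniform (by omega) hγ0 hγ hγN (M.abs_coeff_le hB hβ hA) x

lemma abs_pow_succ_mul_sub_le (j : ℕ) (x : ℝ) :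
    |(B : ℝ) ^ (j + 1) * x - ((B * ⌊(B : ℝ) ^ j * x⌋ : ℤ) : ℝ)| ≤ B := by
  have h : (B : ℝ) ^ (j + 1) * x - ((B * ⌊(B : ℝ) ^ j * x⌋ : ℤ) : ℝ)
      = B * Int.fract ((B : ℝ) ^ j * x) := by
    rw [← Int.self_sub_floor]
    push_cast
    ring
  rw [h, abs_of_nonneg (mul_nonneg (by positivity) (Int.fract_nonneg _))]
  exact mul_le_of_le_one_right (by positivity) (Int.fract_lt_one _).le

lemma holderExp_le_beta {N : ℕ} (hN : 1 ≤ N) (hBN : 2 * N + 2 ≤ B) (hβ0 : 0 ≤ β) (hβN : β ≤ N)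
    {A : ℝ} (hA : 0 < A) (x : ℝ) : holderExp (bumpSeries B N (M.coeff A)) x ≤ β := by
  have hB1 : (1 : ℝ) ≤ B := by exact_mod_cast (by omega : 1 ≤ B)
  refine holderExp_bumpSeries_le hN hBN M.coeff_eq_zero hA hβ0 (by linarith) fun h' hh' => ?_
  refine Eventually.frequently ?_
  filter_upwards [eventually_ge_atTop 1] with k hk
  obtain ⟨j, rfl⟩ : ∃ j, k = j + 1 := ⟨k - 1, by omega⟩
  refine ⟨B * ⌊(B : ℝ) ^ j * x⌋, dvd_mul_right _ _, abs_pow_succ_mul_sub_le j x, ?_⟩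
  rw [abs_of_nonneg (M.coeff_nonneg hA.le _ _), coeff, if_pos (dvd_mul_right _ _)]
  refine le_add_of_le_of_nonneg ?_ (M.tsum_zone_nonneg hA.le _ _)
  gcongr

lemma holderExp_le_of_mem {N : ℕ} (hN : 1 ≤ N) (hB : 9 ≤ B) (hBN : 2 * N + 2 ≤ B)
    (hmin0 : 0 < hmin) (hβN : β ≤ N) {A : ℝ} (hA : 0 < A) {i : ℕ} {x : ℝ} (hx : x ∈ M.K i) :
    holderExp (bumpSeries B N (M.coeff A)) x ≤ M.H i x := by
  have hHx := M.H_mem i x hx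
  have hw : 0 < A / 2 / 2 ^ i := by positivity
  refine holderExp_bumpSeries_le hN hBN M.coeff_eq_zero hw (hmin0.le.trans hHx.1)
    (by linarith [hHx.2]) fun h' hh' => ?_
  have hfreq := (Nat.frequently_atTop_iff_infinite.2 (M.infinite_S i)).and_eventually
    (eventually_le_zoneCoeff (S := M.S i) hB (M.continuousOn_H i) hx hh')
  have hfreq' := (tendsto_add_atTop_nat 1).frequently (p := fun k : ℕ => ∃ m : ℤ, (B : ℤ) ∣ m ∧
    |(B : ℝ) ^ k * x - m| ≤ B ∧
      A / 2 / 2 ^ i * (B : ℝ) ^ (-((k : ℝ) * h')) ≤ |M.coeff A k m|) (hfreq.mono ?_)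
  · exact hfreq'
  rintro j ⟨hj, hle⟩
  refine ⟨B * ⌊(B : ℝ) ^ j * x⌋, dvd_mul_right _ _, abs_pow_succ_mul_sub_le j x, ?_⟩
  rw [abs_of_nonneg (M.coeff_nonneg hA.le _ _), coeff]
  refine le_add_of_nonneg_of_le (by split_ifs <;> positivity) ?_
  refine (mul_le_mul_of_nonneg_left (hle hj) hw.le).trans ?_
  exact (M.summable_zone hB hA.le _ _).le_tsum i
    fun i' _ => mul_nonneg (by positivity) (M.zone_nonneg _ _ _)

lemma ρ_pos (hB : 9 ≤ B) (i : ℕ) : 0 < M.ρ i := by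
  have hB0 : (0 : ℝ) < B := by exact_mod_cast (by omega : 0 < B)
  have h1 := M.inv_pow_le i
  have h2 : 0 < ((B : ℝ) ^ (M.l i))⁻¹ := by positivity
  linarith

lemma mem_ball_of_mem (hB : 9 ≤ B) {i : ℕ} {x : ℝ} (hx : x ∈ M.K i) :
    x ∈ ball (M.z i) (M.ρ i) := by
  have h1 := M.abs_sub_le i x hx
  have h2 := M.ρ_pos hB i
  rw [Metric.mem_ball, Real.dist_eq]
  linarith

lemma eq_of_mem (hB : 9 ≤ B) {i j : ℕ} {x : ℝ} (hi : x ∈ M.K i) (hj : x ∈ M.K j) : i = j := by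
  rcases lt_trichotomy i j with h | h | h
  · exact absurd (M.mem_ball_of_mem hB hj) (M.notMem_ball j i h x hi)
  · exact h
  · exact absurd (M.mem_ball_of_mem hB hi) (M.notMem_ball i j h x hj)

lemma holderExp_eq_of_mem {N : ℕ} (hN : 1 ≤ N) (hB : 9 ≤ B) (hBN : 2 * N + 2 ≤ B)
    (hmin0 : 0 < hmin) (hβ : hmin ≤ β) (hβN : β ≤ N) {A : ℝ} (hA : 0 < A) {i : ℕ} {x : ℝ}
    (hx : x ∈ M.K i) : holderExp (bumpSeries B N (M.coeff A)) x = M.H i x := by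
  have hHx := M.H_mem i x hx
  refine le_antisymm (M.holderExp_le_of_mem hN hB hBN hmin0 hβN hA hx) ?_
  refine le_holderExp (hmin0.trans_le hHx.1) fun γ hγ0 hγ => ?_
  refine M.holderAt_bumpSeries_coeff hB hmin0 hβ hA.le hγ0 (by linarith [hHx.2])
    (by linarith [hHx.2]) (fun j hj => ?_) ?_
  · rwa [M.eq_of_mem hB hj hx]
  · filter_upwards [eventually_gt_atTop i] with j hj using M.notMem_ball j i hj x hx

lemma holderExp_eq_beta {N : ℕ} (hN : 1 ≤ N) (hB : 9 ≤ B) (hBN : 2 * N + 2 ≤ B) (hmin0 : 0 < hmin)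
    (hβ : hmin ≤ β) (hβN : β ≤ N) {A : ℝ} (hA : 0 < A) {x : ℝ} (hx : ∀ i, x ∉ M.K i)
    (hx' : ∀ᶠ i in atTop, x ∉ ball (M.z i) (M.ρ i)) :
    holderExp (bumpSeries B N (M.coeff A)) x = β := by
  refine le_antisymm (M.holderExp_le_beta hN hBN (by linarith) hβN hA x) ?_
  refine le_holderExp (by linarith) fun γ hγ0 hγ => ?_
  exact M.holderAt_bumpSeries_coeff hB hmin0 hβ hA.le hγ0 (by linarith) hγ
    (fun i hi => absurd hi (hx i)) hx'

lemma hmin_le_holderExp {N : ℕ} (hB : 9 ≤ B) (hmin0 : 0 < hmin) (hβ : hmin ≤ β) (hβN : β ≤ N)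
    {A : ℝ} (hA : 0 < A) (x : ℝ) : (hmin : EReal) ≤ holderExp (bumpSeries B N (M.coeff A)) x :=
  le_holderExp hmin0 fun _ hγ0 hγ => M.holderAt_of_lt_hmin hB hβ hA.le hγ0 (by linarith) hγ x

lemma continuous_bumpSeries_coeff {N : ℕ} (hB : 9 ≤ B) (hmin0 : 0 < hmin) (hβ : hmin ≤ β)
    (hβN : β ≤ N) {A : ℝ} (hA : 0 < A) : Continuous (bumpSeries B N (M.coeff A)) :=
  continuous_iff_continuousAt.2 fun x =>
    (M.holderAt_of_lt_hmin hB hβ hA.le (half_pos hmin0) (by linarith) (by linarith) x).continuousAt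
      (half_pos hmin0)

lemma bumpSeries_coeff_mem_Icc {N : ℕ} (hB : 9 ≤ B) (hmin0 : 0 < hmin) (hβ : hmin ≤ β) (x : ℝ) :
    bumpSeries B N (M.coeff ((1 - (B : ℝ) ^ (-hmin)) / 2)) x ∈ Icc (0 : ℝ) 1 := by
  have hB1 : (1 : ℝ) < B := by exact_mod_cast (by omega : 1 < B)
  have hA : 0 < 1 - (B : ℝ) ^ (-hmin) := by
    linarith [Real.rpow_lt_one_of_one_lt_of_neg hB1 (by linarith : -hmin < 0)]
  set A := (1 - (B : ℝ) ^ (-hmin)) / 2 with hAdef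
  have hA0 : 0 ≤ A := by positivity
  refine ⟨tsum_nonneg fun k => mul_nonneg (M.coeff_nonneg hA0 _ _) (bumpPoly_fract_nonneg N _), ?_⟩
  have hS := (hasSum_rpow_neg_mul (by omega : 2 ≤ B) hmin0).mul_left (2 * A)
  have hone : 2 * A * (1 - (B : ℝ) ^ (-hmin))⁻¹ = 1 := by
    rw [hAdef]
    field_simp
  rw [hone] at hS
  refine hS.tsum_eq ▸ (summable_bumpSeries (by omega) hmin0 (M.abs_coeff_le hB hβ hA0) x).tsum_le_tsum
    (fun k => ?_) hS.summable
  exact (mul_le_of_le_one_right (M.coeff_nonneg hA0 _ _) (bumpPoly_fract_le_one N _)).trans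
    (M.coeff_le hB hβ hA0 _ _)

end ZoneFamily

/-! ### Existence of the families and prescription of exponents -/

lemma dimH_limsup_ball_eq_zero {z ρ : ℕ → ℝ} (hρ : ∀ i, ρ i ≤ (1 / 2) ^ i) :
    dimH {x | ∃ᶠ i in atTop, x ∈ ball (z i) (ρ i)} = 0 := by
  set E := {x | ∃ᶠ i in atTop, x ∈ ball (z i) (ρ i)} with hE
  refine le_antisymm (le_of_forall_gt_imp_ge_of_dense fun d hd => ?_) bot_le
  induction d with
  | top => exact le_top
  | coe d =>
  have hd0 : (0 : ℝ) < d := by exact_mod_cast hd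
  have hdiam : ∀ i, ediam (ball (z i) (ρ i)) ≤ 2 * 2⁻¹ ^ i := fun i => by
    rw [Real.ball_eq_Ioo, Real.ediam_Ioo]
    calc ENNReal.ofReal (z i + ρ i - (z i - ρ i)) ≤ ENNReal.ofReal (2 * 2⁻¹ ^ i) := by
          refine ENNReal.ofReal_le_ofReal ?_
          have := hρ i
          rw [one_div] at this
          linarith
      _ = 2 * 2⁻¹ ^ i := by
          rw [ENNReal.ofReal_mul zero_le_two, ENNReal.ofReal_pow (by positivity),
            ENNReal.ofReal_inv_of_pos two_pos, ENNReal.ofReal_ofNat]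
  set θ : ℝ≥0∞ := 2⁻¹ ^ (d : ℝ) with hθ
  have hθ1 : θ < 1 := ENNReal.rpow_lt_one (by simp) hd0
  have hr : Tendsto (fun n : ℕ => (2 : ℝ≥0∞) * 2⁻¹ ^ n) atTop (𝓝 0) := by
    have := ENNReal.Tendsto.const_mul (a := 2)
      (ENNReal.tendsto_pow_atTop_nhds_zero_of_lt_one (r := 2⁻¹) (by simp)) (Or.inr (by simp))
    rwa [mul_zero] at this
  have hcover := Measure.hausdorffMeasure_le_liminf_tsum d E (ι := fun _ : ℕ => ℕ) _ hr
    (fun n i => ball (z (n + i)) (ρ (n + i)))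
    (Eventually.of_forall fun n i => (hdiam _).trans (by
      gcongr 2 * ?_
      exact pow_le_pow_right_of_le_one' (by simp) (Nat.le_add_right _ _)))
    (Eventually.of_forall fun n x hx => by
      obtain ⟨i, hi, hxi⟩ := (frequently_atTop.1 hx) n
      refine mem_iUnion.2 ⟨i - n, ?_⟩
      rwa [Nat.add_sub_cancel' hi])
  have hsum : ∀ n, ∑' i, ediam (ball (z (n + i)) (ρ (n + i))) ^ (d : ℝ)
      ≤ 2 ^ (d : ℝ) * (1 - θ)⁻¹ * θ ^ n := fun n => by
    calc _ ≤ ∑' i, 2 ^ (d : ℝ) * θ ^ n * θ ^ i := by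
          refine ENNReal.tsum_le_tsum fun i => ?_
          refine (ENNReal.rpow_le_rpow (hdiam _) hd0.le).trans (le_of_eq ?_)
          rw [ENNReal.mul_rpow_of_nonneg _ _ hd0.le, mul_assoc, ← pow_add, hθ,
            ← ENNReal.rpow_natCast, ← ENNReal.rpow_natCast, ← ENNReal.rpow_mul, ← ENNReal.rpow_mul,
            mul_comm (d : ℝ)]
      _ = _ := by
          rw [ENNReal.tsum_mul_left, ENNReal.tsum_geometric]
          ring
  have hlim : Tendsto (fun n : ℕ => 2 ^ (d : ℝ) * (1 - θ)⁻¹ * θ ^ n) atTop (𝓝 0) := by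
    have := ENNReal.Tendsto.const_mul (a := 2 ^ (d : ℝ) * (1 - θ)⁻¹)
      (ENNReal.tendsto_pow_atTop_nhds_zero_of_lt_one hθ1) (Or.inr (ENNReal.mul_ne_top
        (ENNReal.rpow_ne_top_of_nonneg hd0.le (by simp))
        (ENNReal.inv_ne_top.2 (tsub_pos_of_lt hθ1).ne')))
    rwa [mul_zero] at this
  have hzero : μH[d] E = 0 := by
    refine le_antisymm (hcover.trans ?_) bot_le
    rw [← hlim.liminf_eq]
    exact liminf_le_liminf (Eventually.of_forall hsum)
  exact dimH_le_of_hausdorffMeasure_ne_top (by simp [hzero])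

lemma exists_scales (c : ℕ) (Q Λ : ℕ → ℕ) : ∃ R l : ℕ → ℕ, ∀ i, i + Q i ≤ R i ∧
    l i = c * (R i + 2) ∧ ∀ j < i, l j + Λ j * Q i + 1 ≤ R i := by
  let R : ℕ → ℕ → ℕ := fun i t => i + Q i + t + ∑ j ∈ Finset.range i, (Λ j * Q i + 1)
  let T : ℕ → ℕ := fun i => Nat.rec 0 (fun i t => t + c * (R i t + 2)) i
  have hT : ∀ i, ∑ j ∈ Finset.range i, c * (R j (T j) + 2) = T i := fun i => by
    induction i with
    | zero => rfl
    | succ i ih => rw [Finset.sum_range_succ, ih]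
  refine ⟨fun i => R i (T i), fun i => c * (R i (T i) + 2), fun i => ⟨?_, rfl, fun j hj => ?_⟩⟩
  · simp only [R]
    omega
  · have h1 := Finset.single_le_sum (f := fun j => c * (R j (T j) + 2)) (fun _ _ => Nat.zero_le _)
      (Finset.mem_range.2 hj)
    rw [hT] at h1
    have h2 := Finset.single_le_sum (f := fun j => Λ j * Q i + 1) (fun _ _ => Nat.zero_le _)
      (Finset.mem_range.2 hj)
    have h3 : R i (T i) = i + Q i + T i + ∑ j ∈ Finset.range i, (Λ j * Q i + 1) := rfl
    simp only at h1 h2 ⊢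
    omega

lemma inv_pow_le_abs_sub_of_fract_mem {B e q : ℕ} (hB : 9 ≤ B) (hqe : q ≤ e) (r : ℤ) {x : ℝ}
    (hx : Int.fract ((B : ℝ) ^ e * x) ∈ Icc (2 / B : ℝ) (4 / B)) :
    ((B : ℝ) ^ (e + 1))⁻¹ ≤ |x - r / (B : ℝ) ^ q| := by
  have hB9 : (9 : ℝ) ≤ B := by exact_mod_cast hB
  have hB0 : (0 : ℝ) < B := by linarith
  have h_int : (B : ℝ) ^ e * (r / (B : ℝ) ^ q) = ((r * (B : ℤ) ^ (e - q) : ℤ) : ℝ) := by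
    have : (B : ℝ) ^ e = (B : ℝ) ^ q * (B : ℝ) ^ (e - q) := by rw [← pow_add]; congr 1; omega
    rw [this]
    push_cast
    field_simp
  set p : ℤ := r * (B : ℤ) ^ (e - q) with hp
  have h1 : (B : ℝ)⁻¹ ≤ |(B : ℝ) ^ e * x - p| := by
    have hf := Int.self_sub_floor ((B : ℝ) ^ e * x)
    set n := ⌊(B : ℝ) ^ e * x⌋
    have h2 : (B : ℝ)⁻¹ ≤ 2 / B := by
      rw [inv_eq_one_div]
      gcongr
      norm_num
    have h3 : (B : ℝ)⁻¹ ≤ 1 - 4 / B := by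
      rw [inv_eq_one_div, le_sub_iff_add_le, ← add_div, div_le_one hB0]
      linarith
    rw [le_abs]
    rcases le_or_gt p n with hpn | hpn
    · left
      have : (p : ℝ) ≤ n := by exact_mod_cast hpn
      linarith [hx.1]
    · right
      have : (n : ℝ) + 1 ≤ p := by exact_mod_cast hpn
      linarith [hx.2]
  have h2 : |(B : ℝ) ^ e * x - p| = (B : ℝ) ^ e * |x - r / (B : ℝ) ^ q| := by
    rw [← h_int, ← mul_sub, abs_mul, abs_of_pos (by positivity : (0 : ℝ) < (B : ℝ) ^ e)]
  rw [h2] at h1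
  rw [pow_succ, mul_inv, ← div_eq_inv_mul, div_le_iff₀' (by positivity)]
  exact h1

/-- Cantor sets with prescribed exponents and dimensions of level sets, each one of them repeated
densely. -/
theorem exists_zoneFamily {B : ℕ} (hB : 9 ≤ B) {hmin β : ℝ} (hmin0 : 0 < hmin) (hβ : hmin ≤ β)
    {F L : ℕ → ℕ} {a b : ℕ → ℝ} (hFL : ∀ n, F n < L n) (ha : ∀ n, hmin ≤ a n)
    (hab : ∀ n, a n ≤ b n) (hb : ∀ n, b n ≤ β) :
    ∃ (M : ZoneFamily B hmin β) (ν : ℕ → ℕ), (∀ i, M.ρ i ≤ (1 / 2) ^ i) ∧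
      (∀ n u v, u < v → ∃ i, ν i = n ∧ M.K i ⊆ Ioo u v) ∧ (∀ i, dimH (M.K i) < 1) ∧
      (∀ i, MapsTo (M.H i) (M.K i) (Icc (a (ν i)) (b (ν i)))) ∧
      ∀ i, ∀ t ∈ Icc (a (ν i)) (b (ν i)), {x ∈ M.K i | M.H i x = t}.Nonempty ∧
        dimH {x ∈ M.K i | M.H i x = t} = (((F (ν i) : NNReal) / L (ν i) : NNReal) : ℝ≥0∞) := by
  have hB9 : (9 : ℝ) ≤ B := by exact_mod_cast hB
  have hB0 : (0 : ℝ) < B := by linarith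
  let e : ℕ ≃ ℕ × ℕ × ℤ := (Denumerable.eqv (ℕ × ℕ × ℤ)).symm
  obtain ⟨c, hc⟩ := exists_nat_ge (max 1 (2 * β / hmin))
  have hc1 : 1 ≤ c := by exact_mod_cast (le_max_left _ _).trans hc
  have hcβ : 2 * β ≤ c * hmin := (div_le_iff₀ hmin0).1 ((le_max_right _ _).trans hc)
  obtain ⟨R, l, hRl⟩ := exists_scales c (fun i => (e i).2.1) (fun i => L (e i).1)
  have hRl' : ∀ i, R i + 2 ≤ l i := fun i => by
    rw [(hRl i).2.1]
    exact Nat.le_mul_of_pos_left _ hc1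
  have hpow : ∀ i, 16 * ((B : ℝ) ^ l i)⁻¹ ≤ ((B : ℝ) ^ R i)⁻¹ := fun i => by
    have h1 : (B : ℝ) ^ R i * (B : ℝ) ^ 2 ≤ (B : ℝ) ^ l i := by
      rw [← pow_add]
      exact pow_le_pow_right₀ (by linarith) (hRl' i)
    have h2 : (16 : ℝ) ≤ (B : ℝ) ^ 2 := by nlinarith
    rw [← div_eq_mul_inv, div_le_iff₀ (by positivity), ← div_eq_inv_mul, le_div_iff₀ (by positivity)]
    nlinarith [(by positivity : (0 : ℝ) < (B : ℝ) ^ R i)]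
  choose K H hKc hHc hmap hKsub hfr hdim hlev using fun i : ℕ =>
    exists_cantor_translate (q := (e i).2.1) (l := l i) hB (hFL (e i).1) (hab (e i).1) (e i).2.2
      (by have := (hRl i).1; have := hRl' i; omega)
  have hKz : ∀ i, ∀ x ∈ K i, |x - (e i).2.2 / (B : ℝ) ^ (e i).2.1| ≤ ((B : ℝ) ^ R i)⁻¹ / 4 := by
    intro i x hx
    have h1 := hKsub i hx
    have h2 : 4 / B / (B : ℝ) ^ l i ≤ 4 * ((B : ℝ) ^ l i)⁻¹ := by
      rw [div_eq_mul_inv _ ((B : ℝ) ^ l i)]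
      gcongr
      exact div_le_self (by norm_num) (by linarith)
    rw [abs_of_nonneg (by linarith [h1.1])]
    linarith [h1.2, hpow i]
  refine ⟨
    { K := K
      S := fun i => range fun g => l i + L (e i).1 * g
      H := H
      z := fun i => (e i).2.2 / (B : ℝ) ^ (e i).2.1
      ρ := fun i => ((B : ℝ) ^ R i)⁻¹
      l := l
      isClosed_K := hKc
      continuousOn_H := hHc
      H_mem := fun i x hx => ⟨(ha _).trans (hmap i hx).1, (hmap i hx).2.trans (hb _)⟩
      infinite_S := fun i => infinite_range_of_injective fun g g' h => ?_
      l_le := ?_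
      fract_mem := ?_
      abs_sub_le := hKz
      inv_pow_le := fun i => by linarith [hpow i]
      rpow_le := fun i => ?_
      notMem_ball := fun i j hj x hx => ?_ }, fun i => (e i).1, fun i => ?_, fun n u v huv => ?_, hdim,
    hmap, hlev⟩
  · have hL : 0 < L (e i).1 := (Nat.zero_le _).trans_lt (hFL _)
    exact Nat.eq_of_mul_eq_mul_left hL (Nat.add_left_cancel h)
  · rintro i _ ⟨g, rfl⟩
    exact Nat.le_add_right _ _
  · rintro i x hx _ ⟨g, rfl⟩
    exact hfr i x hx g
  · have h1 : (B : ℝ) ^ (-((l i : ℝ) * (hmin / 2))) ≤ (B : ℝ) ^ (-(((R i + 1 : ℕ) : ℝ) * β)) := by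
      refine Real.rpow_le_rpow_of_exponent_le (by linarith) (neg_le_neg ?_)
      rw [(hRl i).2.1]
      push_cast
      have : (0 : ℝ) ≤ R i := by positivity
      nlinarith
    refine h1.trans ?_
    rw [rpow_neg_natCast_mul (by omega)]
    refine Real.rpow_le_rpow (by positivity) ?_ (by linarith)
    rw [pow_succ, mul_inv, div_eq_mul_inv]
    gcongr
    linarith
  · have h1 : (e i).2.1 ≤ l j + L (e j).1 * (e i).2.1 := by
      have hL : 0 < L (e j).1 := (Nat.zero_le _).trans_lt (hFL _)
      exact (Nat.le_mul_of_pos_left _ hL).trans (Nat.le_add_left _ _)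
    have h2 := inv_pow_le_abs_sub_of_fract_mem hB h1 (e i).2.2 (hfr j x hx _)
    rw [Metric.mem_ball, Real.dist_eq, not_lt]
    refine le_trans ?_ h2
    exact inv_anti₀ (by positivity) (pow_le_pow_right₀ (by linarith) ((hRl i).2.2 j hj))
  · rw [one_div, inv_pow]
    refine inv_anti₀ (by positivity) ?_
    exact (pow_le_pow_left₀ (by norm_num) (by linarith) i).trans
      (pow_le_pow_right₀ (by linarith : (1 : ℝ) ≤ B) (by have := (hRl i).1; omega))
  · obtain ⟨q, hq⟩ := exists_pow_lt_of_lt_one (by linarith : 0 < (v - u) / 2)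
      (inv_lt_one_of_one_lt₀ (by linarith : (1 : ℝ) < B))
    rw [inv_pow] at hq
    have hq0 : (0 : ℝ) < (B : ℝ) ^ q := by positivity
    set r : ℤ := ⌊(B : ℝ) ^ q * u⌋ + 1 with hr
    refine ⟨e.symm (n, q, r), by simp, fun x hx => ?_⟩
    have h1 := hKz _ x hx
    have h2 := (hKsub _ hx).1
    have h3 : ((B : ℝ) ^ R (e.symm (n, q, r)))⁻¹ ≤ ((B : ℝ) ^ q)⁻¹ := by
      refine inv_anti₀ (by positivity) (pow_le_pow_right₀ (by linarith) ?_)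
      have := (hRl (e.symm (n, q, r))).1
      simp only [Equiv.apply_symm_apply] at this
      omega
    simp only [Equiv.apply_symm_apply] at h1 h2
    have h4 : u < r / (B : ℝ) ^ q := by
      rw [lt_div_iff₀ hq0, hr, mul_comm]
      push_cast
      exact Int.lt_floor_add_one _
    have h5 : r / (B : ℝ) ^ q ≤ u + ((B : ℝ) ^ q)⁻¹ := by
      rw [div_le_iff₀ hq0, add_mul, inv_mul_cancel₀ hq0.ne', hr, mul_comm u]
      push_cast
      linarith [Int.floor_le ((B : ℝ) ^ q * u)]
    have h6 := (abs_le.1 h1).2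
    exact ⟨by linarith, by linarith⟩

lemma volume_eq_zero_of_dimH_lt_one {s : Set ℝ} (hs : dimH s < 1) : volume s = 0 := by
  rw [← hausdorffMeasure_real]
  exact_mod_cast hausdorffMeasure_of_dimH_lt (d := 1) (by exact_mod_cast hs)

theorem exists_prescribed_holderExp {hmin β : ℝ} (hmin0 : 0 < hmin) (hβ : hmin ≤ β)
    {F L : ℕ → ℕ} {a b : ℕ → ℝ} (hFL : ∀ n, F n < L n) (ha : ∀ n, hmin ≤ a n)
    (hab : ∀ n, a n ≤ b n) (hb : ∀ n, b n ≤ β) :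
    ∃ Z : ℝ → ℝ, Continuous Z ∧ (∀ x, Z x ∈ Icc (0 : ℝ) 1) ∧
      (∀ x, (hmin : EReal) ≤ holderExp Z x ∧ holderExp Z x ≤ β) ∧
      (∀ n, ∀ t ∈ Icc (a n) (b n), ∀ u v, u < v →
        {x ∈ Ioo u v | holderExp Z x = t}.Nonempty ∧
        (((F n : NNReal) / L n : NNReal) : ℝ≥0∞) ≤ dimH {x ∈ Ioo u v | holderExp Z x = t}) ∧
      (∀ t < β, ∀ D : ℝ≥0∞,
        (∀ n, t ∈ Icc (a n) (b n) → (((F n : NNReal) / L n : NNReal) : ℝ≥0∞) ≤ D) →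
        dimH {x | holderExp Z x = t} ≤ D) ∧
      volume {x | holderExp Z x ≠ β} = 0 := by
  set N := ⌈β⌉₊ + 1 with hNdef
  have hN : 1 ≤ N := by omega
  have hβN : β ≤ N := by
    rw [hNdef]
    push_cast
    linarith [Nat.le_ceil β]
  set B := 2 * N + 10 with hBdef
  have hB : 9 ≤ B := by omega
  have hBN : 2 * N + 2 ≤ B := by omega
  have hB1 : (1 : ℝ) < B := by exact_mod_cast (by omega : 1 < B)
  obtain ⟨M, ν, hρ, hdense, hdim, hmap, hlev⟩ :=
    exists_zoneFamily hB hmin0 hβ hFL ha hab hb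
  set A := (1 - (B : ℝ) ^ (-hmin)) / 2 with hAdef
  have hA : 0 < A := by
    have := Real.rpow_lt_one_of_one_lt_of_neg hB1 (by linarith : -hmin < 0)
    rw [hAdef]
    linarith
  set Z := bumpSeries B N (M.coeff A) with hZ
  have hexpK : ∀ i, ∀ x ∈ M.K i, holderExp Z x = M.H i x := fun i x hx =>
    M.holderExp_eq_of_mem hN hB hBN hmin0 hβ hβN hA hx
  set E := {x | ∃ᶠ i in atTop, x ∈ ball (M.z i) (M.ρ i)} with hEdef
  have hE : dimH E = 0 := dimH_limsup_ball_eq_zero hρ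
  have hexp : ∀ x, x ∉ E → (∀ i, x ∉ M.K i) → holderExp Z x = β := fun x hxE hxK =>
    M.holderExp_eq_beta hN hB hBN hmin0 hβ hβN hA hxK (not_frequently.1 hxE)
  refine ⟨Z, M.continuous_bumpSeries_coeff hB hmin0 hβ hβN hA,
    M.bumpSeries_coeff_mem_Icc hB hmin0 hβ, fun x => ⟨M.hmin_le_holderExp hB hmin0 hβ hβN hA x,
      M.holderExp_le_beta hN hBN (by linarith) hβN hA x⟩, fun n t ht u v huv => ?_,
    fun t ht D hD => ?_, ?_⟩
  · obtain ⟨i, rfl, hsub⟩ := hdense n u v huv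
    obtain ⟨hne, heq⟩ := hlev i t ht
    have hss : {x ∈ M.K i | M.H i x = t} ⊆ {x ∈ Ioo u v | holderExp Z x = t} :=
      fun x hx => ⟨hsub hx.1, by rw [hexpK i x hx.1, hx.2]⟩
    exact ⟨hne.mono hss, heq ▸ dimH_mono hss⟩
  · have hss : {x | holderExp Z x = t} ⊆ E ∪ ⋃ i, {x ∈ M.K i | M.H i x = t} := by
      intro x hx
      by_contra hcon
      rw [mem_union, not_or, mem_iUnion, not_exists] at hcon
      by_cases hK : ∃ i, x ∈ M.K i
      · obtain ⟨i, hi⟩ := hK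
        refine hcon.2 i ⟨hi, ?_⟩
        have h1 := (hexpK i x hi).symm.trans hx
        exact_mod_cast h1
      · have h1 := (hexp x hcon.1 (not_exists.1 hK)).symm.trans hx
        have h2 : β = t := by exact_mod_cast h1
        exact ht.ne' h2
    refine (dimH_mono hss).trans ?_
    rw [dimH_union, hE, dimH_iUnion]
    refine max_le bot_le (iSup_le fun i => ?_)
    by_cases hti : t ∈ Icc (a (ν i)) (b (ν i))
    · rw [(hlev i t hti).2]
      exact hD _ hti
    · have : {x ∈ M.K i | M.H i x = t} = ∅ := by
        refine eq_empty_of_forall_notMem fun x hx => hti ?_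
        rw [← hx.2]
        exact hmap i hx.1
      rw [this, dimH_empty]
      exact bot_le
  · refine measure_mono_null (t := E ∪ ⋃ i, M.K i) (fun x hx => ?_) (measure_union_null ?_ ?_)
    · by_contra hcon
      rw [mem_union, not_or, mem_iUnion, not_exists] at hcon
      exact hx (hexp x hcon.1 hcon.2)
    · exact volume_eq_zero_of_dimH_lt_one (by simp [hE])
    · exact measure_iUnion_null fun i => volume_eq_zero_of_dimH_lt_one (hdim i)

lemma EReal.le_of_forall_natCast_div_le {v w : EReal} (hv : v ≤ 1) (hw : 0 ≤ w)
    (h : ∀ F L : ℕ, F < L → ((((F : NNReal) / L : NNReal) : ℝ≥0∞) : EReal) ≤ v →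
      ((((F : NNReal) / L : NNReal) : ℝ≥0∞) : EReal) ≤ w) : v ≤ w := by
  refine le_of_forall_lt fun c hc => ?_
  obtain ⟨q, hcq, hqv⟩ := EReal.exists_rat_btwn_of_lt hc
  rcases lt_or_ge q 0 with hq | hq
  · refine hcq.trans (lt_of_lt_of_le ?_ hw)
    exact_mod_cast hq
  · have hq1 : q < 1 := by
      have := hqv.trans_le hv
      exact_mod_cast this
    have hnum : ((q.num.toNat : ℤ)) = q.num := Int.toNat_of_nonneg (Rat.num_nonneg.2 hq)
    have hlt : q.num.toNat < q.den := by
      have h1 : q.num < q.den := Rat.num_lt_denom_iff.2 hq1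
      omega
    have heq : ((((q.num.toNat : NNReal) / q.den : NNReal) : ℝ≥0∞) : EReal) = ((q : ℝ) : EReal) := by
      rw [EReal.coe_nnreal_eq_coe_real]
      congr 1
      push_cast
      rw [Rat.cast_def]
      congr 1
      exact_mod_cast hnum
    exact hcq.trans_le (heq ▸ h _ _ hlt (heq.trans_le hqv.le))

lemma dimHE_of_nonempty {s : Set ℝ} (hs : s.Nonempty) : dimHE s = ((dimH s : ℝ≥0∞) : EReal) :=
  if_pos hs

lemma dimHE_empty : dimHE ∅ = ⊥ := if_neg Set.not_nonempty_empty

lemma dimHE_eq_one_of_volume_ne_zero {s : Set ℝ} (hs : volume s ≠ 0) : dimHE s = 1 := by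
  rw [dimHE_of_nonempty (nonempty_of_measure_ne_zero hs)]
  have h1 : dimH s ≤ 1 := (dimH_mono (subset_univ s)).trans Real.dimH_univ.le
  have h2 : 1 ≤ dimH s := by
    rw [← hausdorffMeasure_real] at hs
    exact_mod_cast le_dimH_of_hausdorffMeasure_ne_zero (d := 1) (by exact_mod_cast hs)
  rw [le_antisymm h1 h2, EReal.coe_ennreal_one]

lemma MemF.exists_intervals {f : ℝ → EReal} (hf : MemF f) :
    ∃ (p q : ℕ → ℝ) (v : ℕ → EReal), (∀ n, p n ≤ q n) ∧ (∀ n, q n ≤ 1) ∧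
      (∀ n, 0 ≤ v n ∧ v n ≤ 1) ∧ 0 < sInf {x | ⊥ < f x} ∧ (∀ n, sInf {x | ⊥ < f x} ≤ p n) ∧
      ∀ x, f x = ⨆ n, (if x ∈ Icc (p n) (q n) then v n else ⊥) := by
  obtain ⟨I, v, hI, hI1, ⟨c, hc, hcI⟩, hv, -, hfv⟩ := hf
  choose p q hpq hIpq using hI
  obtain rfl : I = fun n => Icc (p n) (q n) := funext hIpq
  have hsupp : ∀ x, ⊥ < f x ↔ ∃ n, x ∈ Icc (p n) (q n) := fun x => by
    rw [hfv, lt_iSup_iff]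
    refine exists_congr fun n => ?_
    split_ifs with h
    · exact ⟨fun _ => h, fun _ => (EReal.bot_lt_zero).trans_le (hv n).1⟩
    · exact ⟨fun h' => absurd h' (lt_irrefl _), fun h' => absurd h' h⟩
  have hlow : ∀ x ∈ {x | ⊥ < f x}, c ≤ x := fun x hx => by
    obtain ⟨n, hn⟩ := (hsupp x).1 hx
    exact hcI n x hn
  have hmem : ∀ n, p n ∈ {x | ⊥ < f x} := fun n => (hsupp _).2 ⟨n, left_mem_Icc.2 (hpq n)⟩
  exact ⟨p, q, v, hpq, fun n => (hI1 n (right_mem_Icc.2 (hpq n))).2, hv,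
    hc.trans_le (le_csInf ⟨p 0, hmem 0⟩ hlow), fun n => csInf_le ⟨c, hlow⟩ (hmem n),
    fun x => (hfv x).trans (iSup_congr fun n => by congr)⟩

/-- Prescription of the multifractal spectrum of a homogeneously multifractal, non-monotone
continuous function: for `0 < α < β` and `f ∈ 𝓕`, there exists a continuous HM function
`Z : [0,1] → [0,1]` with `d_Z(h) = max (f ((h-α)/(β-α))) 0` for all
`h ∈ (α + (β-α)·Support*(f)) \ {β}` (where `Support*(f) = [sInf Support(f), 1]`, so that
`α + (β-α)·Support*(f) = [α + (β-α)·sInf Support(f), β]`), `d_Z(h) = -∞` for every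
exponent `h` outside `α + (β-α)·Support*(f)`, and `{x ∈ [0,1] : h_Z(x) = β}` of
Lebesgue measure `1`. -/
theorem prescription_HM_nonmonotone (α β : ℝ) (hα : 0 < α) (hαβ : α < β)
    (f : ℝ → EReal) (hf : MemF f) :
    ∃ Z : ℝ → ℝ, Continuous Z ∧
      Set.MapsTo Z (Set.Icc (0:ℝ) 1) (Set.Icc (0:ℝ) 1) ∧ IsHMF Z ∧
      (∀ h : ℝ, h ∈ Set.Icc (α + (β - α) * sInf {x : ℝ | ⊥ < f x}) β → h ≠ β →
        specF Z (h : EReal) = max (f ((h - α) / (β - α))) 0) ∧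
      (∀ h : ℝ, 0 ≤ h → h ∉ Set.Icc (α + (β - α) * sInf {x : ℝ | ⊥ < f x}) β →
        specF Z (h : EReal) = ⊥) ∧
      volume {x ∈ Set.Icc (0:ℝ) 1 | holderExp Z x = (β : EReal)} = 1 := by
  obtain ⟨p, q, v, hpq, hq1, hv, hs0, hsp, hfv⟩ := hf.exists_intervals
  set s := sInf {x : ℝ | ⊥ < f x} with hs
  have hβα : 0 < β - α := sub_pos.2 hαβ
  have hs1 : s ≤ 1 := (hsp 0).trans ((hpq 0).trans (hq1 0))
  set hmin := α + (β - α) * s with hmin_def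
  have hmin0 : 0 < hmin := by positivity
  have hminβ : hmin ≤ β := by nlinarith
  let e : ℕ ≃ ℕ × ℕ × ℕ := (Denumerable.eqv (ℕ × ℕ × ℕ)).symm
  -- A triple `(n, F, L)` with `F < L` and `F / L ≤ v n` prescribes the dimension `F / L` on the
  -- interval `[p n, q n]`; any other triple prescribes the dimension `0` on `[s, 1]`.
  let G : ℕ → Prop := fun k => (e k).2.1 < (e k).2.2 ∧
    (((((e k).2.1 : NNReal) / (e k).2.2 : NNReal) : ℝ≥0∞) : EReal) ≤ v (e k).1
  obtain ⟨Z, hZc, hZ01, hexp, hlow, hupp, hvol⟩ := exists_prescribed_holderExp hmin0 hminβ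
    (F := fun k => if G k then (e k).2.1 else 0) (L := fun k => if G k then (e k).2.2 else 1)
    (a := fun k => if G k then α + (β - α) * p (e k).1 else hmin)
    (b := fun k => if G k then α + (β - α) * q (e k).1 else β)
    (fun k => by
      split_ifs with h
      · exact h.1
      · exact one_pos)
    (fun k => by
      split_ifs
      · have := hsp (e k).1
        rw [hmin_def]
        gcongr
      · exact le_rfl)
    (fun k => by
      split_ifs
      · have := hpq (e k).1
        gcongr
      · exact hminβ)
    (fun k => by
      split_ifs
      · nlinarith [hq1 (e k).1]
      · exact le_rfl)
  have hbad : ¬ G (e.symm (0, 1, 0)) := by simp [G]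
  -- The level sets in an arbitrary set with nonempty interior.
  have hempty : ∀ (U : Set ℝ) (h : EReal), ¬ ((hmin : EReal) ≤ h ∧ h ≤ β) →
      dimHE {x ∈ U | holderExp Z x = h} = ⊥ := fun U h hh => by
    have : {x ∈ U | holderExp Z x = h} = ∅ :=
      eq_empty_of_forall_notMem fun x hx => hh (hx.2 ▸ hexp x)
    rw [this, dimHE_empty]
  have hfull : ∀ (U : Set ℝ), volume {x ∈ U | holderExp Z x = β} = volume U := fun U => by
    refine measure_congr ?_
    have : ∀ᵐ x, holderExp Z x = β := hvol
    filter_upwards [this] with x hx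
    exact propext ⟨fun h => h.1, fun h => ⟨h, hx⟩⟩
  have hone : ∀ (U : Set ℝ) (a b : ℝ), a < b → Ioo a b ⊆ U →
      dimHE {x ∈ U | holderExp Z x = β} = 1 := fun U a b hab hU => by
    refine dimHE_eq_one_of_volume_ne_zero ?_
    rw [hfull]
    refine ne_of_gt (lt_of_lt_of_le ?_ (measure_mono hU))
    simpa using hab
  have hmid : ∀ (U : Set ℝ) (a b : ℝ), a < b → Ioo a b ⊆ U → ∀ t : ℝ, hmin ≤ t → t < β →
      dimHE {x ∈ U | holderExp Z x = t} = max (f ((t - α) / (β - α))) 0 := by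
    intro U a b hab hU t ht1 ht2
    have hIcc : ∀ n, t ∈ Icc (α + (β - α) * p n) (α + (β - α) * q n) ↔
        (t - α) / (β - α) ∈ Icc (p n) (q n) := fun n => by
      rw [mem_Icc, mem_Icc, le_div_iff₀ hβα, div_le_iff₀ hβα]
      constructor <;> rintro ⟨h1, h2⟩ <;> constructor <;> linarith
    have hss : {x ∈ Ioo a b | holderExp Z x = t} ⊆ {x ∈ U | holderExp Z x = t} :=
      fun x hx => ⟨hU hx.1, hx.2⟩
    have hne := (hlow (e.symm (0, 1, 0)) t (by simp [hbad, ht1, ht2.le]) a b hab).1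
    rw [dimHE_of_nonempty (hne.mono hss)]
    refine le_antisymm ?_ (max_le ?_ (EReal.coe_ennreal_nonneg _))
    · have hD := hupp t ht2 (max (f ((t - α) / (β - α))) 0).toENNReal fun k hk => by
        rw [← EReal.coe_ennreal_le_coe_ennreal_iff, EReal.coe_toENNReal (le_max_right _ _)]
        by_cases hG : G k
        · simp only [hG, if_true] at hk ⊢
          refine hG.2.trans (le_max_of_le_left ?_)
          rw [hfv]
          refine le_iSup_of_le (e k).1 ?_
          rw [if_pos ((hIcc _).1 hk)]
        · simp [hG]
      rw [← EReal.coe_ennreal_le_coe_ennreal_iff, EReal.coe_toENNReal (le_max_right _ _)] at hD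
      refine le_trans ?_ hD
      exact EReal.coe_ennreal_le_coe_ennreal_iff.2 (dimH_mono fun x hx => hx.2)
    · rw [hfv]
      refine iSup_le fun n => ?_
      split_ifs with hn
      · refine EReal.le_of_forall_natCast_div_le (hv n).2 (EReal.coe_ennreal_nonneg _)
          fun F L hFL hFLv => ?_
        have hG : G (e.symm (n, F, L)) := by
          simp only [G, Equiv.apply_symm_apply]
          exact ⟨hFL, hFLv⟩
        have h1 := (hlow (e.symm (n, F, L)) t (by
          simp only [hG, if_true, Equiv.apply_symm_apply]
          exact (hIcc n).2 hn) a b hab).2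
        simp only [hG, if_true, Equiv.apply_symm_apply] at h1
        exact EReal.coe_ennreal_le_coe_ennreal_iff.2 (h1.trans (dimH_mono hss))
      · exact bot_le
  have hIoo : Ioo (0 : ℝ) 1 ⊆ Icc 0 1 := Ioo_subset_Icc_self
  refine ⟨Z, hZc, fun x _ => hZ01 x, fun a b _ hab _ h => ?_, fun h hh hne => ?_,
    fun h _ hh => ?_, ?_⟩
  · unfold specF
    by_cases hh : (hmin : EReal) ≤ h ∧ h ≤ β
    · lift h to ℝ using ⟨ne_top_of_le_ne_top (EReal.coe_ne_top β) hh.2,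
        ne_bot_of_le_ne_bot (EReal.coe_ne_bot hmin) hh.1⟩
      simp only [EReal.coe_le_coe_iff] at hh
      rcases hh.2.eq_or_lt with rfl | hlt
      · rw [hone _ a b hab subset_rfl, hone _ 0 1 one_pos hIoo]
      · rw [hmid _ a b hab subset_rfl h hh.1 hlt, hmid _ 0 1 one_pos hIoo h hh.1 hlt]
    · rw [hempty _ h hh, hempty _ h hh]
  · exact hmid _ 0 1 one_pos hIoo h hh.1 (hh.2.lt_of_ne hne)
  · refine hempty _ _ fun hcon => hh ?_
    simpa only [mem_Icc, EReal.coe_le_coe_iff] using hcon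
  · rw [hfull]
    simp
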